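/- arXiv:2307.09039 — 3 statements merged into one kernel-verified Lean document; each statement's English description precedes it below -/
import Mathlib

section
/- Let d ≥ 1, T > 0, M ≥ 1. For 1 ≤ m ≤ M let A_m, S_m : [0,T] → (d×d real matrices) be Lipschitz in t with every value symmetric positive definite, and f_m : [0,T] → ℝ^d Lipschitz. Let u solve u'(t) = −Σ_{m=1}^M ( A_m(t) u(t) + S_m(t) u(t) + f_m(t) ), u(0) = u_0. For N ∈ ℕ, Δt = T/N, t^n = nΔt, define the Marchuk–Yanenko sequential splitting iterates by u^0 = u_0 and, for each n and m = 1,…,M: u^{n+m/M} = (I + Δt·S_m(t^{n+1}))^{−1} [ u^{n+(m−1)/M} − Δt·A_m(t^n) u^{n+(m−1)/M} − Δt·f_m(t^{n+1}) ]. Then the scheme is first-order accurate: there exist C > 0 and N₀ such that for all N ≥ N₀ and 0 ≤ n ≤ N, ‖u^n − u(t^n)‖ ≤ C·Δt. -/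
open Finset

/-- Apply a `d × d` real matrix to a vector of `EuclideanSpace ℝ (Fin d)`
(so that norms are Euclidean norms). -/
noncomputable def matApp {d : ℕ} (A : Matrix (Fin d) (Fin d) ℝ)
    (v : EuclideanSpace ℝ (Fin d)) : EuclideanSpace ℝ (Fin d) :=
  Matrix.toEuclideanCLM (𝕜 := ℝ) A v

/-- The substeps of one step of the Marchuk–Yanenko sequential splitting scheme:
`seqSub d A S f Δt tn tn1 un m = u^{n+m/M}`, starting from `un = u^n` at time `tn`
(with `tn1 = tn + Δt`). -/
noncomputable def seqSub (d : ℕ)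
    (A : ℕ → ℝ → Matrix (Fin d) (Fin d) ℝ)
    (S : ℕ → ℝ → Matrix (Fin d) (Fin d) ℝ)
    (f : ℕ → ℝ → EuclideanSpace ℝ (Fin d))
    (Δt tn tn1 : ℝ) (un : EuclideanSpace ℝ (Fin d)) :
    ℕ → EuclideanSpace ℝ (Fin d)
  | 0 => un
  | (m + 1) =>
      let prev := seqSub d A S f Δt tn tn1 un m
      matApp ((1 + Δt • S (m + 1) tn1)⁻¹)
        (prev - Δt • matApp (A (m + 1) tn) prev - Δt • f (m + 1) tn1)

theorem norm_le_norm_add_smul_of_inner_nonneg {E : Type*} [NormedAddCommGroup E]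
    [InnerProductSpace ℝ E] {h : ℝ} (hh : 0 ≤ h) {x y : E} (hxy : 0 ≤ inner ℝ x y) :
    ‖x‖ ≤ ‖x + h • y‖ := by
  have h1 := norm_add_sq_real x (h • y)
  rw [inner_smul_right] at h1
  have h2 : 0 ≤ h * inner ℝ x y := mul_nonneg hh hxy
  refine le_of_sq_le_sq ?_ (norm_nonneg _)
  nlinarith [sq_nonneg ‖h • y‖]

/-- Distance between the substeps of a sequential splitting step and the corresponding
explicit Euler substeps with all operators evaluated at a fixed vector `v`. -/
theorem norm_splitting_sub_euler_le {E : Type*} [NormedAddCommGroup E]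
    [InnerProductSpace ℝ E] {M : ℕ} {h K B : ℝ} (hh : 0 ≤ h) (hK : 0 ≤ K) (hB : 0 ≤ B)
    {a s : ℕ → E →L[ℝ] E} {g w : ℕ → E} {v : E}
    (ha : ∀ m ∈ Finset.Icc 1 M, ‖a m‖ ≤ K) (hs : ∀ m ∈ Finset.Icc 1 M, ‖s m‖ ≤ K)
    (hs_nonneg : ∀ m ∈ Finset.Icc 1 M, ∀ x, 0 ≤ inner ℝ x (s m x))
    (hF : ∀ m ∈ Finset.Icc 1 M, ‖a m v + s m v + g m‖ ≤ B)
    (hw : ∀ m < M, w (m + 1) + h • s (m + 1) (w (m + 1))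
      = w m - h • a (m + 1) (w m) - h • g (m + 1)) :
    ∀ m ≤ M, ‖w m - (v - h • ∑ j ∈ Finset.Icc 1 m, (a j v + s j v + g j))‖
      ≤ (1 + h * K) ^ m * (‖w 0 - v‖ + m * (2 * K * M * B * h ^ 2)) := by
  set P : ℕ → E := fun m => ∑ j ∈ Finset.Icc 1 m, (a j v + s j v + g j) with hP
  have hPb : ∀ m ≤ M, ‖P m‖ ≤ M * B := by
    intro m hm
    calc ‖P m‖ ≤ ∑ j ∈ Finset.Icc 1 m, B := norm_sum_le_of_le _ fun j hj => hF j (by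
          simp only [Finset.mem_Icc] at hj ⊢; omega)
      _ = m * B := by simp
      _ ≤ M * B := by gcongr
  intro m
  induction m with
  | zero => intro _; simp
  | succ m ih =>
    intro hm
    have ih := ih (by omega)
    have hmem : m + 1 ∈ Finset.Icc 1 M := by simp only [Finset.mem_Icc]; omega
    have hPs : P (m + 1) = P m + (a (m + 1) v + s (m + 1) v + g (m + 1)) :=
      Finset.sum_Icc_succ_top (by omega) _
    change ‖w (m + 1) - (v - h • P (m + 1))‖ ≤ _
    change ‖w m - (v - h • P m)‖ ≤ _ at ih
    set e := w m - (v - h • P m) with he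
    set e' := w (m + 1) - (v - h • P (m + 1)) with he'
    have key : e' + h • s (m + 1) e'
        = e - h • a (m + 1) e + h • (h • (a (m + 1) (P m) + s (m + 1) (P (m + 1)))) := by
      have h1 : e' + h • s (m + 1) e' = (w (m + 1) + h • s (m + 1) (w (m + 1)))
          - (v - h • P (m + 1)) - h • s (m + 1) (v - h • P (m + 1)) := by
        rw [he', map_sub]; module
      rw [h1, hw m (by omega), he, map_sub, map_sub, map_sub, map_smul, map_smul]
      nth_rewrite 1 [hPs]
      module
    have h1 : ‖e'‖ ≤ ‖e' + h • s (m + 1) e'‖ :=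
      norm_le_norm_add_smul_of_inner_nonneg hh (hs_nonneg _ hmem _)
    have h2 : ‖a (m + 1) e‖ ≤ K * ‖e‖ := (a (m + 1)).le_of_opNorm_le (ha _ hmem) e
    have h3 : ‖a (m + 1) (P m)‖ ≤ K * (M * B) :=
      ((a (m + 1)).le_of_opNorm_le (ha _ hmem) _).trans
        (mul_le_mul_of_nonneg_left (hPb m (by omega)) hK)
    have h4 : ‖s (m + 1) (P (m + 1))‖ ≤ K * (M * B) :=
      ((s (m + 1)).le_of_opNorm_le (hs _ hmem) _).trans
        (mul_le_mul_of_nonneg_left (hPb (m + 1) hm) hK)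
    have hq : 1 ≤ (1 + h * K) ^ (m + 1) := one_le_pow₀ (by nlinarith [mul_nonneg hh hK])
    have hc : 0 ≤ 2 * K * M * B * h ^ 2 := by positivity
    calc ‖e'‖ ≤ ‖e - h • a (m + 1) e
          + h • (h • (a (m + 1) (P m) + s (m + 1) (P (m + 1))))‖ := key ▸ h1
      _ ≤ ‖e‖ + h * ‖a (m + 1) e‖
          + h * (h * (‖a (m + 1) (P m)‖ + ‖s (m + 1) (P (m + 1))‖)) := by
        refine (norm_add_le _ _).trans (add_le_add ((norm_sub_le _ _).trans ?_) ?_)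
        · rw [norm_smul, Real.norm_of_nonneg hh]
        · rw [norm_smul, norm_smul, Real.norm_of_nonneg hh]
          gcongr
          exact norm_add_le _ _
      _ ≤ ‖e‖ + h * (K * ‖e‖) + h * (h * (K * (M * B) + K * (M * B))) := by gcongr
      _ = (1 + h * K) * ‖e‖ + 2 * K * M * B * h ^ 2 := by ring
      _ ≤ (1 + h * K) * ((1 + h * K) ^ m * (‖w 0 - v‖ + m * (2 * K * M * B * h ^ 2)))
          + (1 + h * K) ^ (m + 1) * (2 * K * M * B * h ^ 2) := by
        refine add_le_add ?_ (le_mul_of_one_le_left hc hq)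
        gcongr
      _ = _ := by push_cast; ring

/-- First-order Taylor estimate for a curve whose derivative is Lipschitz. -/
theorem norm_sub_sub_smul_le_of_hasDerivAt {E : Type*} [NormedAddCommGroup E]
    [NormedSpace ℝ E] {u G : ℝ → E} {T L : ℝ} (hL : 0 ≤ L)
    (hu : ∀ t ∈ Set.Icc 0 T, HasDerivAt u (G t) t)
    (hG : ∀ x ∈ Set.Icc 0 T, ∀ y ∈ Set.Icc 0 T, ‖G x - G y‖ ≤ L * |x - y|)
    {x y : ℝ} (hx : x ∈ Set.Icc 0 T) (hy : y ∈ Set.Icc 0 T) (hxy : x ≤ y) :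
    ‖u y - u x - (y - x) • G x‖ ≤ L * (y - x) ^ 2 := by
  have hsub : ∀ t ∈ Set.Icc x y, t ∈ Set.Icc 0 T := fun t ht =>
    ⟨hx.1.trans ht.1, ht.2.trans hy.2⟩
  have h := (convex_Icc x y).norm_image_sub_le_of_norm_hasDerivWithin_le
    (f := fun t => u t - t • G x) (f' := fun t => G t - (1 : ℝ) • G x) (C := L * (y - x))
    (fun t ht => ((hu t (hsub t ht)).sub ((hasDerivAt_id t).smul_const _)).hasDerivWithinAt)
    (fun t ht => by
      rw [one_smul]
      refine (hG t (hsub t ht) x hx).trans ?_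
      rw [abs_of_nonneg (by linarith [ht.1])]
      exact mul_le_mul_of_nonneg_left (by linarith [ht.2]) hL)
    (Set.left_mem_Icc.2 hxy) (Set.right_mem_Icc.2 hxy)
  rw [Real.norm_of_nonneg (by linarith)] at h
  calc _ = ‖u y - y • G x - (u x - x • G x)‖ := by congr 1; module
    _ ≤ L * (y - x) * (y - x) := h
    _ = _ := by ring

theorem le_pow_mul_of_le_mul_add {E : ℕ → ℝ} {N : ℕ} {q r : ℝ} (hq : 1 ≤ q) (hr : 0 ≤ r)
    (h0 : E 0 = 0) (hE : ∀ n < N, E (n + 1) ≤ q * (E n + r)) :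
    ∀ n ≤ N, E n ≤ q ^ n * (n * r) := by
  intro n
  induction n with
  | zero => intro _; simp [h0]
  | succ n ih =>
    intro hn
    have hq0 : 0 ≤ q := by linarith
    calc E (n + 1) ≤ q * (E n + r) := hE n (by omega)
      _ ≤ q * (q ^ n * (n * r) + q ^ n * r) := by
        gcongr
        · exact ih (by omega)
        · exact le_mul_of_one_le_left hr (one_le_pow₀ hq)
      _ = _ := by push_cast; ring

/-- A finite family of functions that are Lipschitz on `[0, T]` is uniformly bounded there. -/
theorem exists_norm_le_of_lipschitzOnWith {F : Type*} [NormedAddCommGroup F] {T : ℝ}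
    (hT : 0 ≤ T) (I : Finset ℕ) {g : ℕ → ℝ → F} {L : NNReal}
    (hg : ∀ m ∈ I, LipschitzOnWith L (g m) (Set.Icc 0 T)) :
    ∃ K : ℝ, 0 ≤ K ∧ ∀ m ∈ I, ∀ t ∈ Set.Icc (0 : ℝ) T, ‖g m t‖ ≤ K := by
  refine ⟨∑ m ∈ I, ‖g m 0‖ + L * T, by positivity, fun m hm t ht => ?_⟩
  have h1 := (hg m hm).norm_sub_le ht (Set.left_mem_Icc.2 hT)
  rw [sub_zero, Real.norm_of_nonneg ht.1] at h1
  have h2 : ‖g m 0‖ ≤ ∑ m ∈ I, ‖g m 0‖ :=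
    Finset.single_le_sum (f := fun m => ‖g m 0‖) (fun i _ => norm_nonneg _) hm
  have h3 : (L : ℝ) * t ≤ L * T := mul_le_mul_of_nonneg_left ht.2 L.2
  linarith [norm_le_norm_add_norm_sub' (g m t) (g m 0)]

theorem norm_apply_sub_apply_le {E : Type*} [NormedAddCommGroup E] [NormedSpace ℝ E]
    {a b : E →L[ℝ] E} {x y : E} {K α β : ℝ} (hK : 0 ≤ K) (hα : 0 ≤ α)
    (hab : ‖a - b‖ ≤ α) (hb : ‖b‖ ≤ K) (hx : ‖x‖ ≤ K) (hxy : ‖x - y‖ ≤ β) :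
    ‖a x - b y‖ ≤ α * K + K * β := by
  have h : a x - b y = (a - b) x + b (x - y) := by
    rw [map_sub, sub_apply]; abel
  rw [h]
  refine (norm_add_le _ _).trans (add_le_add ?_ ?_)
  · exact ((a - b).le_of_opNorm_le hab x).trans (mul_le_mul_of_nonneg_left hx hα)
  · exact (b.le_of_opNorm_le hb _).trans (mul_le_mul_of_nonneg_left hxy hK)

theorem sequential_splitting_error_le {E : Type*} [NormedAddCommGroup E]
    [InnerProductSpace ℝ E] {M : ℕ} {T K : ℝ} (hT : 0 < T) (hK : 0 ≤ K)
    {a s : ℕ → ℝ → E →L[ℝ] E} {f : ℕ → ℝ → E} {u : ℝ → E}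
    (ha : ∀ m ∈ Finset.Icc 1 M, ∀ t ∈ Set.Icc 0 T, ‖a m t‖ ≤ K)
    (hs : ∀ m ∈ Finset.Icc 1 M, ∀ t ∈ Set.Icc 0 T, ‖s m t‖ ≤ K)
    (hf : ∀ m ∈ Finset.Icc 1 M, ∀ t ∈ Set.Icc 0 T, ‖f m t‖ ≤ K)
    (hub : ∀ t ∈ Set.Icc 0 T, ‖u t‖ ≤ K)
    (ha_lip : ∀ m ∈ Finset.Icc 1 M, ∀ x ∈ Set.Icc 0 T, ∀ y ∈ Set.Icc 0 T,
      ‖a m x - a m y‖ ≤ K * |x - y|)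
    (hs_lip : ∀ m ∈ Finset.Icc 1 M, ∀ x ∈ Set.Icc 0 T, ∀ y ∈ Set.Icc 0 T,
      ‖s m x - s m y‖ ≤ K * |x - y|)
    (hf_lip : ∀ m ∈ Finset.Icc 1 M, ∀ x ∈ Set.Icc 0 T, ∀ y ∈ Set.Icc 0 T,
      ‖f m x - f m y‖ ≤ K * |x - y|)
    (hs_nonneg : ∀ m ∈ Finset.Icc 1 M, ∀ t ∈ Set.Icc 0 T, ∀ x, 0 ≤ inner ℝ x (s m t x))
    (hu : ∀ t ∈ Set.Icc 0 T, HasDerivAt u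
      (-(∑ m ∈ Finset.Icc 1 M, (a m t (u t) + s m t (u t) + f m t))) t) :
    ∃ C > (0 : ℝ), ∀ N : ℕ, 1 ≤ N → ∀ w : ℕ → ℕ → E, w 0 0 = u 0 →
      (∀ n < N, w (n + 1) 0 = w n M) →
      (∀ n < N, ∀ m < M, w n (m + 1) + (T / N) • s (m + 1) ((n + 1) * (T / N)) (w n (m + 1))
        = w n m - (T / N) • a (m + 1) (n * (T / N)) (w n m)
          - (T / N) • f (m + 1) ((n + 1) * (T / N))) →
      ∀ n ≤ N, ‖w n 0 - u (n * (T / N))‖ ≤ C * (T / N) := by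
  set F : ℕ → ℝ → E := fun m t => a m t (u t) + s m t (u t) + f m t with hFdef
  set B : ℝ := K * K + K * K + K with hBdef
  have hB : 0 ≤ B := by positivity
  have hFmix : ∀ m ∈ Finset.Icc 1 M, ∀ x ∈ Set.Icc 0 T, ∀ y ∈ Set.Icc 0 T,
      ‖a m x (u x) + s m y (u x) + f m y‖ ≤ B := by
    intro m hm x hx y hy
    refine (norm_add₃_le).trans (add_le_add (add_le_add ?_ ?_) (hf m hm y hy))
    · exact ((a m x).le_of_opNorm_le (ha m hm x hx) _).trans
        (mul_le_mul_of_nonneg_left (hub x hx) hK)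
    · exact ((s m y).le_of_opNorm_le (hs m hm y hy) _).trans
        (mul_le_mul_of_nonneg_left (hub x hx) hK)
  have hG : ∀ t ∈ Set.Icc 0 T, ‖-(∑ m ∈ Finset.Icc 1 M, F m t)‖ ≤ M * B := by
    intro t ht
    rw [norm_neg]
    calc _ ≤ ∑ m ∈ Finset.Icc 1 M, B :=
          norm_sum_le_of_le _ fun m hm => hFmix m hm t ht t ht
      _ = M * B := by simp
  have hu_lip : ∀ x ∈ Set.Icc 0 T, ∀ y ∈ Set.Icc 0 T, ‖u x - u y‖ ≤ M * B * |x - y| :=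
    fun x hx y hy => (convex_Icc 0 T).norm_image_sub_le_of_norm_hasDerivWithin_le
      (fun t ht => (hu t ht).hasDerivWithinAt) hG hy hx
  set D : ℝ := (K * K + K * (M * B)) + (K * K + K * (M * B)) + K with hDdef
  have hD : 0 ≤ D := by positivity
  have hF_lip : ∀ m ∈ Finset.Icc 1 M, ∀ x ∈ Set.Icc 0 T, ∀ y ∈ Set.Icc 0 T,
      ‖F m x - F m y‖ ≤ D * |x - y| := by
    intro m hm x hx y hy
    have h1 := norm_apply_sub_apply_le hK (by positivity) (ha_lip m hm x hx y hy)
      (ha m hm y hy) (hub x hx) (hu_lip x hx y hy)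
    have h2 := norm_apply_sub_apply_le hK (by positivity) (hs_lip m hm x hx y hy)
      (hs m hm y hy) (hub x hx) (hu_lip x hx y hy)
    have h3 := hf_lip m hm x hx y hy
    have h4 : F m x - F m y = (a m x (u x) - a m y (u y)) + (s m x (u x) - s m y (u y))
        + (f m x - f m y) := by simp only [hFdef]; abel
    rw [h4]
    refine (norm_add₃_le).trans ((add_le_add (add_le_add h1 h2) h3).trans (le_of_eq ?_))
    rw [hDdef]; ring
  have hG_lip : ∀ x ∈ Set.Icc 0 T, ∀ y ∈ Set.Icc 0 T,
      ‖-(∑ m ∈ Finset.Icc 1 M, F m x) - -(∑ m ∈ Finset.Icc 1 M, F m y)‖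
        ≤ M * D * |x - y| := by
    intro x hx y hy
    rw [← neg_sub', norm_neg, ← Finset.sum_sub_distrib]
    calc _ ≤ ∑ m ∈ Finset.Icc 1 M, D * |x - y| :=
          norm_sum_le_of_le _ fun m hm => hF_lip m hm x hx y hy
      _ = M * D * |x - y| := by simp; ring
  set Q : ℝ := M * (2 * K * M * B) + M * D + M * B with hQdef
  have hQ : 0 ≤ Q := by positivity
  refine ⟨Real.exp (K * M * T) * T * Q + 1, by positivity, ?_⟩
  intro N hN w hw0 hwM hw
  have hNpos : (0 : ℝ) < N := by exact_mod_cast hN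
  set h : ℝ := T / N with hh_def
  have hh : 0 < h := by positivity
  have hNh : N * h = T := by rw [hh_def]; field_simp
  have hgrid : ∀ n : ℕ, n ≤ N → (n : ℝ) * h ∈ Set.Icc 0 T := fun n hn =>
    ⟨by positivity, by rw [← hNh]; gcongr⟩
  have hq1 : 1 ≤ (1 + h * K) ^ M := one_le_pow₀ (by nlinarith [mul_nonneg hh.le hK])
  have hstep : ∀ n < N, ‖w (n + 1) 0 - u ((n + 1 : ℕ) * h)‖
      ≤ (1 + h * K) ^ M * (‖w n 0 - u (n * h)‖ + Q * h ^ 2) := by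
    intro n hn
    have hx := hgrid n hn.le
    have hy : ((n : ℝ) + 1) * h ∈ Set.Icc 0 T := by exact_mod_cast hgrid (n + 1) hn
    rw [hwM n hn]
    push_cast
    set x : ℝ := n * h with hxdef
    set y : ℝ := (n + 1) * h with hydef
    have hyx : y - x = h := by rw [hxdef, hydef]; ring
    set P : E := ∑ m ∈ Finset.Icc 1 M, (a m x (u x) + s m y (u x) + f m y) with hPdef
    have h1 : ‖w n M - (u x - h • P)‖
        ≤ (1 + h * K) ^ M * (‖w n 0 - u x‖ + M * (2 * K * M * B * h ^ 2)) :=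
      norm_splitting_sub_euler_le (a := fun m => a m x) (s := fun m => s m y)
        (g := fun m => f m y) (w := w n) hh.le hK hB
        (fun m hm => ha m hm x hx) (fun m hm => hs m hm y hy)
        (fun m hm => hs_nonneg m hm y hy) (fun m hm => hFmix m hm x hx y hy)
        (hw n hn) M le_rfl
    have h2 := norm_sub_sub_smul_le_of_hasDerivAt (by positivity) hu hG_lip hx hy
      (by linarith)
    rw [hyx] at h2
    have h3 : ‖P - ∑ m ∈ Finset.Icc 1 M, F m x‖ ≤ M * (B * h) := by
      rw [hPdef, ← Finset.sum_sub_distrib]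
      calc _ ≤ ∑ m ∈ Finset.Icc 1 M, B * h := norm_sum_le_of_le _ fun m hm => ?_
        _ = M * (B * h) := by simp
      have h4 : a m x (u x) + s m y (u x) + f m y - F m x
          = (s m y - s m x) (u x) + (f m y - f m x) := by
        simp only [hFdef, sub_apply]; abel
      have habs : |y - x| = h := by rw [hyx, abs_of_pos hh]
      have h5 := hs_lip m hm y hy x hx
      have h6 := hf_lip m hm y hy x hx
      rw [habs] at h5 h6
      rw [h4]
      refine (norm_add_le _ _).trans ?_
      have h7 := ((s m y - s m x).le_of_opNorm_le h5 (u x)).trans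
        (mul_le_mul_of_nonneg_left (hub x hx) (by positivity))
      have h8 : 0 ≤ K * K * h := by positivity
      rw [hBdef]
      linarith
    have h4 : w n M - u y = (w n M - (u x - h • P))
        + (-(u y - u x - h • -(∑ m ∈ Finset.Icc 1 M, F m x))
          + -(h • (P - ∑ m ∈ Finset.Icc 1 M, F m x))) := by module
    have h5 : ‖h • (P - ∑ m ∈ Finset.Icc 1 M, F m x)‖ ≤ h * (M * (B * h)) := by
      rw [norm_smul, Real.norm_of_nonneg hh.le]; gcongr
    have h6 : 0 ≤ (M * D + M * B) * h ^ 2 := by positivity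
    rw [h4]
    calc _ ≤ (1 + h * K) ^ M * (‖w n 0 - u x‖ + M * (2 * K * M * B * h ^ 2))
          + (M * D * h ^ 2 + h * (M * (B * h))) := by
          refine (norm_add_le _ _).trans (add_le_add h1 ((norm_add_le _ _).trans ?_))
          rw [norm_neg, norm_neg]
          exact add_le_add h2 h5
      _ = (1 + h * K) ^ M * (‖w n 0 - u x‖ + M * (2 * K * M * B * h ^ 2))
          + (M * D + M * B) * h ^ 2 := by ring
      _ ≤ (1 + h * K) ^ M * (‖w n 0 - u x‖ + M * (2 * K * M * B * h ^ 2))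
          + (1 + h * K) ^ M * ((M * D + M * B) * h ^ 2) := by
          exact add_le_add le_rfl (le_mul_of_one_le_left h6 hq1)
      _ = _ := by rw [hQdef]; ring
  intro n hn
  have h1 := le_pow_mul_of_le_mul_add (E := fun n => ‖w n 0 - u (n * h)‖) hq1
    (by positivity) (by simp [hw0]) hstep n hn
  have hnT : (n : ℝ) * h ≤ T := (hgrid n hn).2
  have h2 : ((1 + h * K) ^ M) ^ n ≤ Real.exp (K * M * T) := by
    calc ((1 + h * K) ^ M) ^ n ≤ (Real.exp (h * K) ^ M) ^ n := by
          gcongr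
          linarith [Real.add_one_le_exp (h * K)]
      _ = Real.exp (K * M * (n * h)) := by
          rw [← Real.exp_nat_mul, ← Real.exp_nat_mul]; congr 1; ring
      _ ≤ _ := by gcongr
  calc ‖w n 0 - u (n * h)‖ ≤ ((1 + h * K) ^ M) ^ n * (n * (Q * h ^ 2)) := h1
    _ = ((1 + h * K) ^ M) ^ n * ((n * h) * Q * h) := by ring
    _ ≤ Real.exp (K * M * T) * (T * Q * h) := by gcongr
    _ ≤ (Real.exp (K * M * T) * T * Q + 1) * h := by nlinarith

theorem inner_toEuclideanCLM_nonneg {d : ℕ} {S : Matrix (Fin d) (Fin d) ℝ}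
    (hS : S.PosSemidef) (x : EuclideanSpace ℝ (Fin d)) :
    0 ≤ inner ℝ x (Matrix.toEuclideanCLM (𝕜 := ℝ) S x) := by
  have h := hS.dotProduct_mulVec_nonneg x.ofLp
  rw [EuclideanSpace.inner_eq_star_dotProduct, dotProduct_comm]
  simpa using h

theorem matApp_one_add_smul_inv {d : ℕ} {S : Matrix (Fin d) (Fin d) ℝ} (hS : S.PosSemidef)
    {h : ℝ} (hh : 0 ≤ h) (x : EuclideanSpace ℝ (Fin d)) :
    matApp ((1 + h • S)⁻¹) x
      + h • Matrix.toEuclideanCLM (𝕜 := ℝ) S (matApp ((1 + h • S)⁻¹) x) = x := by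
  have hpd : (1 + h • S).PosDef := Matrix.PosDef.one.add_posSemidef (hS.smul hh)
  have hmul : (1 + h • S) * (1 + h • S)⁻¹ = 1 :=
    Matrix.mul_nonsing_inv _ ((Matrix.isUnit_iff_isUnit_det _).1 hpd.isUnit)
  have h1 := congrArg (fun B => Matrix.toEuclideanCLM (𝕜 := ℝ) B x) hmul
  simpa [map_mul, map_add, map_smul, matApp] using h1

/-- **First-order accuracy of the Marchuk–Yanenko sequential splitting scheme.** -/
theorem sequential_splitting_first_order_accurate
    (d M : ℕ) (hd : 1 ≤ d) (hM : 1 ≤ M) (T : ℝ) (hT : 0 < T)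
    (A : ℕ → ℝ → Matrix (Fin d) (Fin d) ℝ)
    (S : ℕ → ℝ → Matrix (Fin d) (Fin d) ℝ)
    (f : ℕ → ℝ → EuclideanSpace ℝ (Fin d))
    (LA LS Lf : NNReal)
    (hA_lip : ∀ m ∈ Finset.Icc 1 M,
      LipschitzOnWith LA (fun t => Matrix.toEuclideanCLM (𝕜 := ℝ) (A m t)) (Set.Icc 0 T))
    (hA_pd : ∀ m ∈ Finset.Icc 1 M, ∀ t ∈ Set.Icc (0 : ℝ) T, (A m t).PosDef)
    (hS_lip : ∀ m ∈ Finset.Icc 1 M,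
      LipschitzOnWith LS (fun t => Matrix.toEuclideanCLM (𝕜 := ℝ) (S m t)) (Set.Icc 0 T))
    (hS_pd : ∀ m ∈ Finset.Icc 1 M, ∀ t ∈ Set.Icc (0 : ℝ) T, (S m t).PosDef)
    (hf_lip : ∀ m ∈ Finset.Icc 1 M, LipschitzOnWith Lf (f m) (Set.Icc 0 T))
    (u0 : EuclideanSpace ℝ (Fin d)) (u : ℝ → EuclideanSpace ℝ (Fin d))
    (hu0 : u 0 = u0)
    (hu : ∀ t ∈ Set.Icc (0 : ℝ) T, HasDerivAt u
      (-(∑ m ∈ Finset.Icc 1 M,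
          (matApp (A m t) (u t) + matApp (S m t) (u t) + f m t))) t)
    (uN : ℕ → ℕ → EuclideanSpace ℝ (Fin d))
    (huN0 : ∀ N, uN N 0 = u0)
    (huNstep : ∀ N n : ℕ, uN N (n + 1) =
      seqSub d A S f (T / N) (n * (T / N)) ((n + 1) * (T / N)) (uN N n) M) :
    ∃ C > (0 : ℝ), ∃ N₀ : ℕ, ∀ N ≥ N₀, ∀ n ≤ N,
      ‖uN N n - u (n * (T / N))‖ ≤ C * (T / N) := by
  obtain ⟨KA, hKA0, hKA⟩ := exists_norm_le_of_lipschitzOnWith hT.le _ hA_lip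
  obtain ⟨KS, hKS0, hKS⟩ := exists_norm_le_of_lipschitzOnWith hT.le _ hS_lip
  obtain ⟨Kf, hKf0, hKf⟩ := exists_norm_le_of_lipschitzOnWith hT.le _ hf_lip
  obtain ⟨Ku, hKu⟩ := (isCompact_Icc (a := (0 : ℝ)) (b := T)).exists_bound_of_continuousOn
    (f := u) fun t ht => (hu t ht).continuousAt.continuousWithinAt
  have hKu0 : 0 ≤ Ku := (norm_nonneg _).trans (hKu 0 (Set.left_mem_Icc.2 hT.le))
  have hLA : (0 : ℝ) ≤ LA := LA.2
  have hLS : (0 : ℝ) ≤ LS := LS.2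
  have hLf : (0 : ℝ) ≤ Lf := Lf.2
  set K : ℝ := KA + KS + Kf + Ku + LA + LS + Lf with hK
  obtain ⟨C, hC, hmain⟩ := sequential_splitting_error_le (M := M) (T := T) (K := K)
    (a := fun m t => Matrix.toEuclideanCLM (𝕜 := ℝ) (A m t))
    (s := fun m t => Matrix.toEuclideanCLM (𝕜 := ℝ) (S m t)) (f := f) (u := u)
    hT (by positivity)
    (fun m hm t ht => (hKA m hm t ht).trans (by linarith))
    (fun m hm t ht => (hKS m hm t ht).trans (by linarith))
    (fun m hm t ht => (hKf m hm t ht).trans (by linarith))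
    (fun t ht => (hKu t ht).trans (by linarith))
    (fun m hm x hx y hy => ((hA_lip m hm).norm_sub_le hx hy).trans
      (mul_le_mul_of_nonneg_right (by linarith) (abs_nonneg _)))
    (fun m hm x hx y hy => ((hS_lip m hm).norm_sub_le hx hy).trans
      (mul_le_mul_of_nonneg_right (by linarith) (abs_nonneg _)))
    (fun m hm x hx y hy => ((hf_lip m hm).norm_sub_le hx hy).trans
      (mul_le_mul_of_nonneg_right (by linarith) (abs_nonneg _)))
    (fun m hm t ht => inner_toEuclideanCLM_nonneg (hS_pd m hm t ht).posSemidef)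
    hu
  refine ⟨C, hC, 1, fun N hN => ?_⟩
  have hNpos : (0 : ℝ) < N := by exact_mod_cast hN
  refine hmain N hN
    (fun n => seqSub d A S f (T / N) (n * (T / N)) ((n + 1) * (T / N)) (uN N n))
    ((huN0 N).trans hu0.symm) (fun n _ => huNstep N n) fun n hn m hm => ?_
  have hle : ((n : ℝ) + 1) * (T / N) ≤ T := by
    calc ((n : ℝ) + 1) * (T / N) ≤ N * (T / N) := by
          gcongr
          exact_mod_cast hn
      _ = T := by field_simp
  exact matApp_one_add_smul_inv
    (hS_pd (m + 1) (by simp only [Finset.mem_Icc]; omega) _ ⟨by positivity, hle⟩).posSemidef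
    (by positivity) _
end

section
/- Let d ≥ 1, T > 0, M ≥ 1. For 1 ≤ m ≤ M let A_m, S_m : [0,T] → (d×d real matrices) be Lipschitz in t with every value symmetric positive definite, and f_m : [0,T] → ℝ^d Lipschitz. Let u solve u'(t) = −Σ_{m=1}^M ( A_m(t) u(t) + S_m(t) u(t) + f_m(t) ), u(0) = u_0. For N ∈ ℕ, Δt = T/N, t^n = nΔt, define the parallel splitting iterates by u^0 = u_0 and, for each n: for m = 1,…,M, u^n_m = (I + M·Δt·S_m(t^{n+1}))^{−1} [ u^n − M·Δt·( A_m(t^n) u^n + f_m(t^{n+1}) ) ], and then u^{n+1} = (1/M) Σ_{m=1}^M u^n_m. Then the scheme is first-order accurate: there exist C > 0 and N₀ such that for all N ≥ N₀ and 0 ≤ n ≤ N, ‖u^n − u(t^n)‖ ≤ C·Δt. -/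
open Finset

/-- One step of the parallel splitting scheme of Lu–Neittaanmäki–Tai:
`u^{n+1} = (1/M) Σ_{m=1}^M (I + M Δt S_m(t^{n+1}))⁻¹ (u^n − M Δt (A_m(t^n) u^n + f_m(t^{n+1})))`. -/
noncomputable def parStep (d M : ℕ)
    (A : ℕ → ℝ → Matrix (Fin d) (Fin d) ℝ)
    (S : ℕ → ℝ → Matrix (Fin d) (Fin d) ℝ)
    (f : ℕ → ℝ → EuclideanSpace ℝ (Fin d))
    (Δt tn tn1 : ℝ) (un : EuclideanSpace ℝ (Fin d)) : EuclideanSpace ℝ (Fin d) :=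
  ((M : ℝ))⁻¹ • ∑ m ∈ Finset.Icc 1 M,
    matApp ((1 + ((M : ℝ) * Δt) • S m tn1)⁻¹)
      (un - ((M : ℝ) * Δt) • (matApp (A m tn) un + f m tn1))

lemma exists_forall_norm_le_of_lipschitzOnWith {ι E : Type*} [SeminormedAddCommGroup E]
    (s : Finset ι) (g : ι → ℝ → E) (L : NNReal) {T : ℝ} (hT : 0 ≤ T)
    (hg : ∀ m ∈ s, LipschitzOnWith L (g m) (Set.Icc 0 T)) :
    ∃ K : ℝ, 0 ≤ K ∧ ∀ m ∈ s, ∀ t ∈ Set.Icc (0 : ℝ) T, ‖g m t‖ ≤ K := by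
  refine ⟨∑ m ∈ s, ‖g m 0‖ + L * T, by positivity, fun m hm t ht => ?_⟩
  have h0 : ‖g m 0‖ ≤ ∑ m ∈ s, ‖g m 0‖ :=
    Finset.single_le_sum (f := fun m => ‖g m 0‖) (fun _ _ => norm_nonneg _) hm
  have h1 : ‖g m t - g m 0‖ ≤ L * ‖t - 0‖ := (hg m hm).norm_sub_le ht ⟨le_rfl, hT⟩
  have h2 : (L : ℝ) * ‖t - 0‖ ≤ L * T := by
    rw [sub_zero, Real.norm_of_nonneg ht.1]
    exact mul_le_mul_of_nonneg_left ht.2 L.2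
  have h3 : ‖g m t‖ ≤ ‖g m 0‖ + ‖g m t - g m 0‖ := norm_le_norm_add_norm_sub' _ _
  linarith

lemma norm_clm_apply_sub_apply_le {E : Type*} [NormedAddCommGroup E] [NormedSpace ℝ E]
    (a b : E →L[ℝ] E) (x y : E) :
    ‖a x - b y‖ ≤ ‖a - b‖ * ‖x‖ + ‖b‖ * ‖x - y‖ := by
  have h : a x - b y = (a - b) x + b (x - y) := by simp
  rw [h]
  exact (norm_add_le _ _).trans (add_le_add ((a - b).le_opNorm x) (b.le_opNorm _))

lemma norm_sub_sub_smul_deriv_le {E : Type*} [NormedAddCommGroup E] [NormedSpace ℝ E]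
    {u G : ℝ → E} {I : Set ℝ} (hI : Convex ℝ I) {L : ℝ} (hL : 0 ≤ L)
    (hu : ∀ t ∈ I, HasDerivAt u (G t) t)
    (hG : ∀ s ∈ I, ∀ t ∈ I, ‖G t - G s‖ ≤ L * |t - s|) {s t : ℝ}
    (hs : s ∈ I) (ht : t ∈ I) (hst : s ≤ t) :
    ‖u t - u s - (t - s) • G s‖ ≤ L * (t - s) ^ 2 := by
  have hsub : Set.Icc s t ⊆ I := hI.ordConnected.out hs ht
  have h := (convex_Icc s t).norm_image_sub_le_of_norm_hasDerivWithin_le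
    (f := fun x => u x - x • G s) (f' := fun x => G x - G s) (C := L * (t - s))
    (fun x hx => ((hu x (hsub hx)).sub (by
      simpa using (hasDerivAt_id x).smul_const (G s))).hasDerivWithinAt)
    (fun x hx => (hG s hs x (hsub hx)).trans (by
      rw [abs_of_nonneg (sub_nonneg.2 hx.1)]
      exact mul_le_mul_of_nonneg_left (by linarith [hx.2]) hL))
    (Set.left_mem_Icc.2 hst) (Set.right_mem_Icc.2 hst)
  rw [Real.norm_of_nonneg (sub_nonneg.2 hst)] at h
  have e : u t - u s - (t - s) • G s = u t - t • G s - (u s - s • G s) := by module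
  rw [e]
  linarith

lemma le_mul_exp_of_forall_succ_le {e : ℕ → ℝ} {a b : ℝ} {N : ℕ} (ha : 0 ≤ a) (hb : 0 ≤ b)
    (h0 : e 0 ≤ 0) (h : ∀ n < N, e (n + 1) ≤ (1 + a) * e n + b) :
    ∀ n ≤ N, e n ≤ n * b * Real.exp (n * a) := by
  intro n
  induction n with
  | zero => simpa using h0
  | succ k ih =>
    intro hk
    have h1 : (1 + a) * e k ≤ Real.exp a * (k * b * Real.exp (k * a)) := by
      have h2 : 1 + a ≤ Real.exp a := by linarith [Real.add_one_le_exp a]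
      calc (1 + a) * e k ≤ (1 + a) * (k * b * Real.exp (k * a)) :=
            mul_le_mul_of_nonneg_left (ih (by omega)) (by linarith)
        _ ≤ _ := mul_le_mul_of_nonneg_right h2 (by positivity)
    have h3 : Real.exp (((k + 1 : ℕ) : ℝ) * a) = Real.exp a * Real.exp (k * a) := by
      rw [← Real.exp_add]; push_cast; ring_nf
    have h4 : b ≤ b * Real.exp (((k + 1 : ℕ) : ℝ) * a) :=
      le_mul_of_one_le_right hb (Real.one_le_exp (by positivity))
    rw [h3] at h4 ⊢
    push_cast
    linarith [h k (by omega)]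

lemma norm_inv_smul_sum_Icc_le {E : Type*} [NormedAddCommGroup E] [NormedSpace ℝ E]
    {M : ℕ} (hM : 1 ≤ M) {x : ℕ → E} {c : ℝ} (hx : ∀ m ∈ Finset.Icc 1 M, ‖x m‖ ≤ c) :
    ‖(M : ℝ)⁻¹ • ∑ m ∈ Finset.Icc 1 M, x m‖ ≤ c := by
  have hM' : (0 : ℝ) < M := by exact_mod_cast hM
  have h : ‖∑ m ∈ Finset.Icc 1 M, x m‖ ≤ M * c := by
    simpa using norm_sum_le_of_le _ hx
  rw [norm_smul, norm_inv, Real.norm_of_nonneg hM'.le, inv_mul_le_iff₀ hM']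
  exact h

lemma norm_le_norm_add_smul_matApp {d : ℕ} {S : Matrix (Fin d) (Fin d) ℝ} (hS : S.PosSemidef)
    {τ : ℝ} (hτ : 0 ≤ τ) (v : EuclideanSpace ℝ (Fin d)) : ‖v‖ ≤ ‖v + τ • matApp S v‖ := by
  have hin : 0 ≤ inner ℝ v (matApp S v) := by
    have := hS.dotProduct_mulVec_nonneg (WithLp.ofLp v)
    simpa [matApp, EuclideanSpace.inner_eq_star_dotProduct, dotProduct_comm] using this
  have h := norm_add_sq_real v (τ • matApp S v)
  rw [inner_smul_right] at h
  exact le_of_sq_le_sq (by nlinarith [mul_nonneg hτ hin, sq_nonneg ‖τ • matApp S v‖])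
    (norm_nonneg _)

lemma norm_matApp_resolvent_sub_le {d : ℕ} {S : Matrix (Fin d) (Fin d) ℝ} (hS : S.PosSemidef)
    {τ : ℝ} (hτ : 0 ≤ τ) (y z : EuclideanSpace ℝ (Fin d)) :
    ‖matApp ((1 + τ • S)⁻¹) y - z‖ ≤ ‖y - (z + τ • matApp S z)‖ := by
  have hdet : IsUnit (1 + τ • S).det :=
    ((Matrix.PosDef.one.add_posSemidef (hS.smul hτ)).det_pos).ne'.isUnit
  have happ (w : EuclideanSpace ℝ (Fin d)) :
      w + τ • matApp S w = Matrix.toEuclideanCLM (𝕜 := ℝ) (1 + τ • S) w := by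
    simp [matApp, map_add, map_smul]
  have hinv : matApp ((1 + τ • S)⁻¹) y + τ • matApp S (matApp ((1 + τ • S)⁻¹) y) = y := by
    rw [happ, matApp, ← mul_apply_eq_comp, ← map_mul, Matrix.mul_nonsing_inv _ hdet]
    simp
  refine (norm_le_norm_add_smul_matApp hS hτ _).trans (le_of_eq ?_)
  congr 1
  conv_rhs => rw [← hinv]
  simp only [matApp, map_sub, smul_sub]
  abel

lemma norm_parStep_sub_parStep_le {d M : ℕ} (hM : 1 ≤ M)
    {A S : ℕ → ℝ → Matrix (Fin d) (Fin d) ℝ} (f : ℕ → ℝ → EuclideanSpace ℝ (Fin d))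
    {Δt tn tn1 K : ℝ} (hΔ : 0 ≤ Δt)
    (hA : ∀ m ∈ Finset.Icc 1 M, ‖Matrix.toEuclideanCLM (𝕜 := ℝ) (A m tn)‖ ≤ K)
    (hS : ∀ m ∈ Finset.Icc 1 M, (S m tn1).PosSemidef) (v w : EuclideanSpace ℝ (Fin d)) :
    ‖parStep d M A S f Δt tn tn1 v - parStep d M A S f Δt tn tn1 w‖ ≤
      (1 + M * Δt * K) * ‖v - w‖ := by
  have hτ : 0 ≤ (M : ℝ) * Δt := by positivity
  unfold parStep
  rw [← smul_sub, ← Finset.sum_sub_distrib]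
  refine norm_inv_smul_sum_Icc_le hM fun m hm => ?_
  have h := norm_matApp_resolvent_sub_le (hS m hm) hτ
    ((v - w) - ((M : ℝ) * Δt) • matApp (A m tn) (v - w)) 0
  have e : (v - ((M : ℝ) * Δt) • (matApp (A m tn) v + f m tn1)) -
      (w - ((M : ℝ) * Δt) • (matApp (A m tn) w + f m tn1)) =
      (v - w) - ((M : ℝ) * Δt) • matApp (A m tn) (v - w) := by
    simp only [matApp, map_sub]
    module
  have e0 : (0 : EuclideanSpace ℝ (Fin d)) + ((M : ℝ) * Δt) • matApp (S m tn1) 0 = 0 := by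
    simp [matApp]
  rw [sub_zero, e0, sub_zero] at h
  have e' : ∀ (R : Matrix (Fin d) (Fin d) ℝ) (x y : EuclideanSpace ℝ (Fin d)),
      matApp R x - matApp R y = matApp R (x - y) := fun R x y => by simp [matApp]
  rw [e', e]
  refine h.trans ((norm_sub_le _ _).trans ?_)
  rw [norm_smul, Real.norm_of_nonneg hτ]
  have hb : ‖matApp (A m tn) (v - w)‖ ≤ K * ‖v - w‖ :=
    (ContinuousLinearMap.le_opNorm _ _).trans
      (mul_le_mul_of_nonneg_right (hA m hm) (norm_nonneg _))
  linarith [mul_le_mul_of_nonneg_left hb hτ]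

/-- One splitting step differs from an explicit Euler step by a second-order quantity. -/
lemma norm_parStep_sub_euler_le {d M : ℕ} (hM : 1 ≤ M)
    {A S : ℕ → ℝ → Matrix (Fin d) (Fin d) ℝ} {f : ℕ → ℝ → EuclideanSpace ℝ (Fin d)}
    {Δt tn tn1 K F LS Lf : ℝ} (hΔ : 0 ≤ Δt) (v : EuclideanSpace ℝ (Fin d))
    (hSpd : ∀ m ∈ Finset.Icc 1 M, (S m tn1).PosSemidef)
    (hS : ∀ m ∈ Finset.Icc 1 M, ‖Matrix.toEuclideanCLM (𝕜 := ℝ) (S m tn1)‖ ≤ K)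
    (hF : ∀ m ∈ Finset.Icc 1 M, ‖matApp (A m tn) v + matApp (S m tn) v + f m tn‖ ≤ F)
    (hSlip : ∀ m ∈ Finset.Icc 1 M, ‖Matrix.toEuclideanCLM (𝕜 := ℝ) (S m tn1) -
      Matrix.toEuclideanCLM (𝕜 := ℝ) (S m tn)‖ ≤ LS * Δt)
    (hflip : ∀ m ∈ Finset.Icc 1 M, ‖f m tn1 - f m tn‖ ≤ Lf * Δt) :
    ‖parStep d M A S f Δt tn tn1 v - (v + Δt • -(∑ m ∈ Finset.Icc 1 M,
      (matApp (A m tn) v + matApp (S m tn) v + f m tn)))‖ ≤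
      (M * (LS * ‖v‖ + Lf) + M ^ 2 * (K * F)) * Δt ^ 2 := by
  have hM' : (M : ℝ) ≠ 0 := by positivity
  have hτ : 0 ≤ (M : ℝ) * Δt := by positivity
  have e : v + Δt • -(∑ m ∈ Finset.Icc 1 M,
      (matApp (A m tn) v + matApp (S m tn) v + f m tn)) =
      (M : ℝ)⁻¹ • ∑ m ∈ Finset.Icc 1 M, (v - ((M : ℝ) * Δt) •
        (matApp (A m tn) v + matApp (S m tn) v + f m tn)) := by
    rw [Finset.sum_sub_distrib, ← Finset.smul_sum, smul_sub, smul_smul, ← mul_assoc,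
      inv_mul_cancel₀ hM', one_mul, smul_neg, sub_eq_add_neg]
    congr 1
    rw [Finset.sum_const, Nat.card_Icc, Nat.add_sub_cancel, ← Nat.cast_smul_eq_nsmul ℝ,
      smul_smul, inv_mul_cancel₀ hM', one_smul]
  rw [e, parStep, ← smul_sub, ← Finset.sum_sub_distrib]
  refine norm_inv_smul_sum_Icc_le hM fun m hm => ?_
  refine (norm_matApp_resolvent_sub_le (hSpd m hm) hτ _ _).trans ?_
  set g := matApp (A m tn) v + matApp (S m tn) v + f m tn with hg
  have e2 : v - ((M : ℝ) * Δt) • (matApp (A m tn) v + f m tn1) -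
      (v - ((M : ℝ) * Δt) • g + ((M : ℝ) * Δt) • matApp (S m tn1) (v - ((M : ℝ) * Δt) • g)) =
      ((M : ℝ) * Δt) • (((M : ℝ) * Δt) • matApp (S m tn1) g -
        (Matrix.toEuclideanCLM (𝕜 := ℝ) (S m tn1) -
          Matrix.toEuclideanCLM (𝕜 := ℝ) (S m tn)) v - (f m tn1 - f m tn)) := by
    have e3 : matApp (S m tn1) (v - ((M : ℝ) * Δt) • g) =
        matApp (S m tn1) v - ((M : ℝ) * Δt) • matApp (S m tn1) g := by
      simp [matApp]
    have e4 : (Matrix.toEuclideanCLM (𝕜 := ℝ) (S m tn1) -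
          Matrix.toEuclideanCLM (𝕜 := ℝ) (S m tn)) v =
        matApp (S m tn1) v - matApp (S m tn) v := rfl
    rw [e3, e4]
    generalize matApp (S m tn1) g = w
    rw [hg]
    module
  rw [e2, norm_smul, Real.norm_of_nonneg hτ]
  have h1 : ‖matApp (S m tn1) g‖ ≤ K * F :=
    (ContinuousLinearMap.le_opNorm _ _).trans (mul_le_mul (hS m hm) (hF m hm) (norm_nonneg _)
      ((norm_nonneg _).trans (hS m hm)))
  have h2 : ‖(Matrix.toEuclideanCLM (𝕜 := ℝ) (S m tn1) -
      Matrix.toEuclideanCLM (𝕜 := ℝ) (S m tn)) v‖ ≤ LS * Δt * ‖v‖ :=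
    (ContinuousLinearMap.le_opNorm _ _).trans
      (mul_le_mul_of_nonneg_right (hSlip m hm) (norm_nonneg _))
  have h3 : ‖((M : ℝ) * Δt) • matApp (S m tn1) g -
        (Matrix.toEuclideanCLM (𝕜 := ℝ) (S m tn1) -
          Matrix.toEuclideanCLM (𝕜 := ℝ) (S m tn)) v - (f m tn1 - f m tn)‖ ≤
      M * Δt * (K * F) + LS * Δt * ‖v‖ + Lf * Δt := by
    refine (norm_sub_le _ _).trans (add_le_add ((norm_sub_le _ _).trans
      (add_le_add ?_ h2)) (hflip m hm))
    rw [norm_smul, Real.norm_of_nonneg hτ]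
    exact mul_le_mul_of_nonneg_left h1 hτ
  refine (mul_le_mul_of_nonneg_left h3 hτ).trans (le_of_eq ?_)
  ring

/-- **First-order accuracy of the parallel splitting scheme.** -/
theorem parallel_splitting_first_order_accurate
    (d M : ℕ) (hd : 1 ≤ d) (hM : 1 ≤ M) (T : ℝ) (hT : 0 < T)
    (A : ℕ → ℝ → Matrix (Fin d) (Fin d) ℝ)
    (S : ℕ → ℝ → Matrix (Fin d) (Fin d) ℝ)
    (f : ℕ → ℝ → EuclideanSpace ℝ (Fin d))
    (LA LS Lf : NNReal)
    (hA_lip : ∀ m ∈ Finset.Icc 1 M,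
      LipschitzOnWith LA (fun t => Matrix.toEuclideanCLM (𝕜 := ℝ) (A m t)) (Set.Icc 0 T))
    (hA_pd : ∀ m ∈ Finset.Icc 1 M, ∀ t ∈ Set.Icc (0 : ℝ) T, (A m t).PosDef)
    (hS_lip : ∀ m ∈ Finset.Icc 1 M,
      LipschitzOnWith LS (fun t => Matrix.toEuclideanCLM (𝕜 := ℝ) (S m t)) (Set.Icc 0 T))
    (hS_pd : ∀ m ∈ Finset.Icc 1 M, ∀ t ∈ Set.Icc (0 : ℝ) T, (S m t).PosDef)
    (hf_lip : ∀ m ∈ Finset.Icc 1 M, LipschitzOnWith Lf (f m) (Set.Icc 0 T))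
    (u0 : EuclideanSpace ℝ (Fin d)) (u : ℝ → EuclideanSpace ℝ (Fin d))
    (hu0 : u 0 = u0)
    (hu : ∀ t ∈ Set.Icc (0 : ℝ) T, HasDerivAt u
      (-(∑ m ∈ Finset.Icc 1 M,
          (matApp (A m t) (u t) + matApp (S m t) (u t) + f m t))) t)
    (uN : ℕ → ℕ → EuclideanSpace ℝ (Fin d))
    (huN0 : ∀ N, uN N 0 = u0)
    (huNstep : ∀ N n : ℕ, uN N (n + 1) =
      parStep d M A S f (T / N) (n * (T / N)) ((n + 1) * (T / N)) (uN N n)) :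
    ∃ C > (0 : ℝ), ∃ N₀ : ℕ, ∀ N ≥ N₀, ∀ n ≤ N,
      ‖uN N n - u (n * (T / N))‖ ≤ C * (T / N) := by
  have hM' : (0 : ℝ) < M := by exact_mod_cast hM
  obtain ⟨KA, hKA0, hKA⟩ := exists_forall_norm_le_of_lipschitzOnWith _
    (fun m t => Matrix.toEuclideanCLM (𝕜 := ℝ) (A m t)) LA hT.le hA_lip
  obtain ⟨KS, hKS0, hKS⟩ := exists_forall_norm_le_of_lipschitzOnWith _
    (fun m t => Matrix.toEuclideanCLM (𝕜 := ℝ) (S m t)) LS hT.le hS_lip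
  obtain ⟨Kf, hKf0, hKf⟩ := exists_forall_norm_le_of_lipschitzOnWith _ f Lf hT.le hf_lip
  obtain ⟨U, hU⟩ := isCompact_Icc.exists_bound_of_continuousOn
    (f := u) (s := Set.Icc 0 T) fun t ht => (hu t ht).continuousAt.continuousWithinAt
  have hU0 : 0 ≤ U := (norm_nonneg _).trans (hU 0 ⟨le_rfl, hT.le⟩)
  have hF : ∀ m ∈ Finset.Icc 1 M, ∀ t ∈ Set.Icc (0 : ℝ) T,
      ‖matApp (A m t) (u t) + matApp (S m t) (u t) + f m t‖ ≤ KA * U + KS * U + Kf := by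
    intro m hm t ht
    refine norm_add₃_le.trans (add_le_add (add_le_add ?_ ?_) (hKf m hm t ht))
    · exact (ContinuousLinearMap.le_opNorm _ _).trans
        (mul_le_mul (hKA m hm t ht) (hU t ht) (norm_nonneg _) hKA0)
    · exact (ContinuousLinearMap.le_opNorm _ _).trans
        (mul_le_mul (hKS m hm t ht) (hU t ht) (norm_nonneg _) hKS0)
  set F := KA * U + KS * U + Kf
  have hF0 : 0 ≤ F := by positivity
  have hulip : ∀ s ∈ Set.Icc (0 : ℝ) T, ∀ t ∈ Set.Icc (0 : ℝ) T,
      ‖u t - u s‖ ≤ M * F * |t - s| := fun s hs t ht =>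
    (convex_Icc 0 T).norm_image_sub_le_of_norm_hasDerivWithin_le
      (fun x hx => (hu x hx).hasDerivWithinAt)
      (fun x hx => by
        rw [norm_neg]
        simpa using norm_sum_le_of_le _ fun m hm => hF m hm x hx) hs ht
  set L : ℝ := M * ((LA * U + KA * (M * F)) + (LS * U + KS * (M * F)) + Lf) with hLdef
  have hL0 : 0 ≤ L := by positivity
  have happ : ∀ (B : ℕ → ℝ → Matrix (Fin d) (Fin d) ℝ) (LB : NNReal) (KB : ℝ),
      (∀ m ∈ Finset.Icc 1 M,
        LipschitzOnWith LB (fun t => Matrix.toEuclideanCLM (𝕜 := ℝ) (B m t)) (Set.Icc 0 T)) →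
      0 ≤ KB → (∀ m ∈ Finset.Icc 1 M, ∀ t ∈ Set.Icc (0 : ℝ) T,
        ‖Matrix.toEuclideanCLM (𝕜 := ℝ) (B m t)‖ ≤ KB) →
      ∀ m ∈ Finset.Icc 1 M, ∀ s ∈ Set.Icc (0 : ℝ) T, ∀ t ∈ Set.Icc (0 : ℝ) T,
        ‖matApp (B m t) (u t) - matApp (B m s) (u s)‖ ≤
          (LB * U + KB * (M * F)) * |t - s| := by
    intro B LB KB hB hKB0 hKB m hm s hs t ht
    refine (norm_clm_apply_sub_apply_le _ _ _ _).trans ?_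
    have h1 := mul_le_mul ((hB m hm).norm_sub_le ht hs) (hU t ht) (norm_nonneg _)
      (by positivity)
    have h2 := mul_le_mul (hKB m hm s hs) (hulip s hs t ht) (norm_nonneg _) hKB0
    rw [Real.norm_eq_abs] at h1
    linarith
  have hG : ∀ s ∈ Set.Icc (0 : ℝ) T, ∀ t ∈ Set.Icc (0 : ℝ) T,
      ‖-(∑ m ∈ Finset.Icc 1 M, (matApp (A m t) (u t) + matApp (S m t) (u t) + f m t)) -
        -(∑ m ∈ Finset.Icc 1 M, (matApp (A m s) (u s) + matApp (S m s) (u s) + f m s))‖ ≤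
        L * |t - s| := by
    intro s hs t ht
    rw [← neg_sub', norm_neg, ← Finset.sum_sub_distrib]
    have h : ∀ m ∈ Finset.Icc 1 M,
        ‖matApp (A m t) (u t) + matApp (S m t) (u t) + f m t -
          (matApp (A m s) (u s) + matApp (S m s) (u s) + f m s)‖ ≤
        ((LA * U + KA * (M * F)) + (LS * U + KS * (M * F)) + Lf) * |t - s| := by
      intro m hm
      rw [add_sub_add_comm, add_sub_add_comm]
      refine norm_add₃_le.trans ?_
      have h1 := happ A LA KA hA_lip hKA0 hKA m hm s hs t ht
      have h2 := happ S LS KS hS_lip hKS0 hKS m hm s hs t ht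
      have h3 := (hf_lip m hm).norm_sub_le ht hs
      rw [Real.norm_eq_abs] at h3
      linarith
    refine (norm_sum_le_of_le _ h).trans (le_of_eq ?_)
    simp [hLdef, mul_assoc]
  set B : ℝ := M * (LS * U + Lf) + M ^ 2 * (KS * F) + L with hBdef
  have hB0 : 0 ≤ B := by positivity
  refine ⟨T * B * Real.exp (T * (M * KA)) + 1, by positivity, 1, fun N hN n hn => ?_⟩
  have hN' : (0 : ℝ) < N := by exact_mod_cast hN
  have hΔ : 0 < T / N := by positivity
  have hNΔ : (N : ℝ) * (T / N) = T := by field_simp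
  generalize hΔdef : T / (N : ℝ) = Δ at *
  have hmem : ∀ k : ℕ, k ≤ N → (k : ℝ) * Δ ∈ Set.Icc (0 : ℝ) T := fun k hk =>
    ⟨by positivity, hNΔ ▸ mul_le_mul_of_nonneg_right (by exact_mod_cast hk) hΔ.le⟩
  have hstep : ∀ k < N, ‖uN N (k + 1) - u ((k + 1 : ℕ) * Δ)‖ ≤
      (1 + M * Δ * KA) * ‖uN N k - u (k * Δ)‖ + B * Δ ^ 2 := by
    intro k hk
    have hs := hmem k hk.le
    have ht := hmem (k + 1) hk
    have hdiff : ((k + 1 : ℕ) : ℝ) * Δ - k * Δ = Δ := by push_cast; ring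
    have h1 := norm_parStep_sub_parStep_le hM f hΔ.le (fun m hm => hKA m hm _ hs)
      (fun m hm => (hS_pd m hm _ ht).posSemidef) (uN N k) (u (k * Δ))
    have h2 := norm_parStep_sub_euler_le (A := A) (f := f) (LS := LS) (Lf := Lf) hM hΔ.le
      (u (k * Δ))
      (fun m hm => (hS_pd m hm _ ht).posSemidef) (fun m hm => hKS m hm _ ht)
      (fun m hm => hF m hm _ hs)
      (fun m hm => by
        simpa only [hdiff, Real.norm_of_nonneg hΔ.le] using (hS_lip m hm).norm_sub_le ht hs)
      (fun m hm => by
        simpa only [hdiff, Real.norm_of_nonneg hΔ.le] using (hf_lip m hm).norm_sub_le ht hs)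
    have h3 := norm_sub_sub_smul_deriv_le (convex_Icc 0 T) hL0 hu hG hs ht (by linarith)
    have h4 : (M * (LS * ‖u (k * Δ)‖ + Lf) + M ^ 2 * (KS * F)) * Δ ^ 2 ≤
        (M * (LS * U + Lf) + M ^ 2 * (KS * F)) * Δ ^ 2 := by
      gcongr
      exact hU _ hs
    rw [hdiff] at h3
    have hrec := huNstep N k
    rw [hΔdef, ← Nat.cast_succ, Nat.succ_eq_add_one] at hrec
    rw [hrec]
    refine (norm_sub_le_norm_sub_add_norm_sub _
      (parStep d M A S f Δ (k * Δ) ((k + 1 : ℕ) * Δ) (u (k * Δ))) _).trans ?_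
    have h5 := norm_sub_le_norm_sub_add_norm_sub
      (parStep d M A S f Δ (k * Δ) ((k + 1 : ℕ) * Δ) (u (k * Δ)))
      (u (k * Δ) + Δ • -(∑ m ∈ Finset.Icc 1 M, (matApp (A m (k * Δ)) (u (k * Δ)) +
        matApp (S m (k * Δ)) (u (k * Δ)) + f m (k * Δ)))) (u ((k + 1 : ℕ) * Δ))
    rw [sub_sub, norm_sub_rev] at h3
    rw [hBdef]
    linarith
  have hfin := le_mul_exp_of_forall_succ_le (e := fun k => ‖uN N k - u (k * Δ)‖)
    (a := M * Δ * KA) (b := B * Δ ^ 2) (by positivity) (by positivity)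
    (by simp [huN0, hu0]) hstep n hn
  have hnT := (hmem n hn).2
  calc ‖uN N n - u (n * Δ)‖ ≤ n * (B * Δ ^ 2) * Real.exp (n * (M * Δ * KA)) := hfin
    _ = (n * Δ) * B * Real.exp ((n * Δ) * (M * KA)) * Δ := by ring_nf
    _ ≤ T * B * Real.exp (T * (M * KA)) * Δ := by gcongr
    _ ≤ (T * B * Real.exp (T * (M * KA)) + 1) * Δ := by linarith
end

section
/- With the data of the general hybrid splitting scheme with relaxation (Algorithm 6), the local truncation error is second order: for every R > 0 there exist C > 0 and Δt₀ > 0 such that for every 0 < Δt ≤ Δt₀, every n with (n+1)Δt ≤ T, and every starting value u^n with ‖u^n‖ ≤ R, one step of the scheme satisfies ‖ u^{n+1} − ( u^n − Δt·Z̃(t^n) u^n − Δt·f(t^n) ) ‖ ≤ C·Δt², where Z̃(t^n) = Σ_{j=1}^{2J−1} Σ_{m=1}^{M_j} Σ_{k=1}^{c_{j,m}} ( Σ_{s=1}^{c_{j,m−1}} A^{j,m}_{k,s}(t^n) + S^{j,m}_k(t^{n+1}) ) + Σ_s A*_s(t^n) + S*(t^{n+1}) and f(t^n) = Σ_{j=1}^{2J−1}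 Σ_{m=1}^{M_j} Σ_{k=1}^{c_{j,m}} f^{j,m}_k(t^n) + f*(t^n). -/
open Finset

/-- The `M_j` substeps performed at one grid level of Algorithm 6.  `pow` is the factor
(`2^{j−1}` in the left branch, `2^{2J−j}` in the right branch), `cj m = c_{j,m}`
(with `cj 0` the channel count of the input), `Am m k s`, `Sm m k`, `fm m k` are the data
already evaluated at the relevant times, and `init` is the pair
(input average, input channels).  The value at `m` is the pair
`(u^{n,j,m}, k ↦ u^{n,j,m}_k)`. -/
noncomputable def levelSub (d : ℕ) (pow : ℝ) (cj : ℕ → ℕ)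
    (Am : ℕ → ℕ → ℕ → Matrix (Fin d) (Fin d) ℝ)
    (Sm : ℕ → ℕ → Matrix (Fin d) (Fin d) ℝ)
    (fm : ℕ → ℕ → EuclideanSpace ℝ (Fin d))
    (Δt : ℝ)
    (init : EuclideanSpace ℝ (Fin d) × (ℕ → EuclideanSpace ℝ (Fin d))) :
    ℕ → EuclideanSpace ℝ (Fin d) × (ℕ → EuclideanSpace ℝ (Fin d))
  | 0 => init
  | (m + 1) =>
      let prev := levelSub d pow cj Am Sm fm Δt init m
      let uk : ℕ → EuclideanSpace ℝ (Fin d) := fun k =>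
        matApp ((1 + (pow * (cj (m + 1) : ℝ) * Δt) • Sm (m + 1) k)⁻¹)
          (prev.1 - (pow * (cj (m + 1) : ℝ) * Δt) •
            ((∑ s ∈ Finset.Icc 1 (cj m), matApp (Am (m + 1) k s) (prev.2 s))
              + fm (m + 1) k))
      (((cj (m + 1) : ℝ))⁻¹ • ∑ k ∈ Finset.Icc 1 (cj (m + 1)), uk k, uk)

/-- The left branch of Algorithm 6: `alg6Left … j = (u^{n,j,M_j}, k ↦ u^{n,j,M_j}_k)`
(for `j = 0` it is the initial data `(u^n, k ↦ u^n)`). -/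
noncomputable def alg6Left (d : ℕ) (M : ℕ → ℕ) (c : ℕ → ℕ → ℕ)
    (A : ℕ → ℕ → ℕ → ℕ → ℝ → Matrix (Fin d) (Fin d) ℝ)
    (S : ℕ → ℕ → ℕ → ℝ → Matrix (Fin d) (Fin d) ℝ)
    (f : ℕ → ℕ → ℕ → ℝ → EuclideanSpace ℝ (Fin d))
    (Δt tn tn1 : ℝ) (un : EuclideanSpace ℝ (Fin d)) :
    ℕ → EuclideanSpace ℝ (Fin d) × (ℕ → EuclideanSpace ℝ (Fin d))
  | 0 => (un, fun _ => un)
  | (j + 1) =>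
      levelSub d ((2 : ℝ) ^ j) (c (j + 1))
        (fun m k s => A (j + 1) m k s tn)
        (fun m k => S (j + 1) m k tn1)
        (fun m k => f (j + 1) m k tn)
        Δt (alg6Left d M c A S f Δt tn tn1 un j) (M (j + 1))

/-- The right branch of Algorithm 6 including the relaxation steps:
`alg6Right … J i = (ū^{n,J+i,M_{J+i}}, k ↦ ū^{n,J+i,M_{J+i}}_k)` for `0 ≤ i ≤ J−1`. -/
noncomputable def alg6Right (d J : ℕ) (M : ℕ → ℕ) (c : ℕ → ℕ → ℕ)
    (A : ℕ → ℕ → ℕ → ℕ → ℝ → Matrix (Fin d) (Fin d) ℝ)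
    (S : ℕ → ℕ → ℕ → ℝ → Matrix (Fin d) (Fin d) ℝ)
    (f : ℕ → ℕ → ℕ → ℝ → EuclideanSpace ℝ (Fin d))
    (Δt tn tn1 : ℝ) (un : EuclideanSpace ℝ (Fin d)) :
    ℕ → EuclideanSpace ℝ (Fin d) × (ℕ → EuclideanSpace ℝ (Fin d))
  | 0 => alg6Left d M c A S f Δt tn tn1 un J
  | (i + 1) =>
      let j := J + i + 1
      let s := levelSub d ((2 : ℝ) ^ (2 * J - j)) (c j)
        (fun m k s => A j m k s tn)
        (fun m k => S j m k tn1)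
        (fun m k => f j m k tn)
        Δt (alg6Right d J M c A S f Δt tn tn1 un i) (M j)
      let relax : ℕ → EuclideanSpace ℝ (Fin d) := fun k =>
        (1 / 2 : ℝ) • s.2 k
          + (1 / 2 : ℝ) • (alg6Left d M c A S f Δt tn tn1 un (2 * J - j)).2 k
      (((c j (M j) : ℝ))⁻¹ • ∑ k ∈ Finset.Icc 1 (c j (M j)), relax k, relax)

/-- One full step `u^n ↦ u^{n+1}` of the general hybrid splitting scheme with relaxation
(Algorithm 6). -/
noncomputable def alg6Step (d J : ℕ) (M : ℕ → ℕ) (c : ℕ → ℕ → ℕ)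
    (A : ℕ → ℕ → ℕ → ℕ → ℝ → Matrix (Fin d) (Fin d) ℝ)
    (S : ℕ → ℕ → ℕ → ℝ → Matrix (Fin d) (Fin d) ℝ)
    (f : ℕ → ℕ → ℕ → ℝ → EuclideanSpace ℝ (Fin d))
    (Astar : ℕ → ℝ → Matrix (Fin d) (Fin d) ℝ)
    (Sstar : ℝ → Matrix (Fin d) (Fin d) ℝ)
    (fstar : ℝ → EuclideanSpace ℝ (Fin d))
    (Δt tn tn1 : ℝ) (un : EuclideanSpace ℝ (Fin d)) : EuclideanSpace ℝ (Fin d) :=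
  let ubar := alg6Right d J M c A S f Δt tn tn1 un (J - 1)
  matApp ((1 + Δt • Sstar tn1)⁻¹)
    (ubar.1 - Δt •
      ((∑ s ∈ Finset.Icc 1 (c (2 * J - 1) (M (2 * J - 1))), matApp (Astar s tn) (ubar.2 s))
        + fstar tn))

section LocalTruncation

open Asymptotics Filter

variable {d : ℕ}

/-- The sum over all substeps and channels of one grid level of the operators and sources
acting on `u`. -/
noncomputable def levelIncrement (cj : ℕ → ℕ) (B : ℕ → ℕ → ℕ → Matrix (Fin d) (Fin d) ℝ)
    (Q : ℕ → ℕ → Matrix (Fin d) (Fin d) ℝ) (f : ℕ → ℕ → EuclideanSpace ℝ (Fin d))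
    (u : EuclideanSpace ℝ (Fin d)) (N : ℕ) : EuclideanSpace ℝ (Fin d) :=
  ∑ m ∈ Icc 1 N, ∑ k ∈ Icc 1 (cj m),
    (((∑ s ∈ Icc 1 (cj (m - 1)), matApp (B m k s) u) + matApp (Q m k) u) + f m k)

theorem norm_le_norm_add_smul_matApp_s15 {B : Matrix (Fin d) (Fin d) ℝ} (hB : B.PosDef)
    {a : ℝ} (ha : 0 ≤ a) (w : EuclideanSpace ℝ (Fin d)) :
    ‖w‖ ≤ ‖w + a • matApp B w‖ := by
  have hpos : 0 ≤ inner ℝ (matApp B w) w := by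
    have h := hB.posSemidef.dotProduct_mulVec_nonneg w.ofLp
    simpa [matApp, EuclideanSpace.inner_eq_star_dotProduct, Matrix.ofLp_toEuclideanCLM] using h
  have hsq : ‖w‖ * ‖w‖ ≤ ‖w + a • matApp B w‖ * ‖w‖ := by
    refine le_trans ?_ (real_inner_le_norm _ _)
    rw [inner_add_left, real_inner_smul_left, real_inner_self_eq_norm_mul_norm]
    nlinarith [mul_nonneg ha hpos]
  rcases (norm_nonneg w).eq_or_lt with h0 | h0
  · rw [← h0]; exact norm_nonneg _
  · exact le_of_mul_le_mul_right hsq h0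

theorem matApp_inv_add_smul {B : Matrix (Fin d) (Fin d) ℝ} (hB : B.PosDef)
    {a : ℝ} (ha : 0 ≤ a) (v : EuclideanSpace ℝ (Fin d)) :
    matApp ((1 + a • B)⁻¹) v + a • matApp B (matApp ((1 + a • B)⁻¹) v) = v := by
  have hdet : IsUnit (1 + a • B).det :=
    (Matrix.isUnit_iff_isUnit_det _).1 (Matrix.PosDef.one.add_posSemidef
      (hB.posSemidef.smul ha)).isUnit
  have h : matApp (1 + a • B) (matApp ((1 + a • B)⁻¹) v) = v := by
    simp only [matApp]
    rw [← mul_apply_eq_comp, ← map_mul, Matrix.mul_nonsing_inv _ hdet, map_one,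
      one_apply_eq_self]
  simpa [matApp] using h

/-- First-order expansion of the resolvent of a positive definite matrix. -/
theorem norm_matApp_inv_sub_le {B : Matrix (Fin d) (Fin d) ℝ} (hB : B.PosDef)
    {a : ℝ} (ha : 0 ≤ a) (v : EuclideanSpace ℝ (Fin d)) :
    ‖matApp ((1 + a • B)⁻¹) v - (v - a • matApp B v)‖
      ≤ a ^ 2 * ‖Matrix.toEuclideanCLM (𝕜 := ℝ) B‖ ^ 2 * ‖v‖ := by
  have hw := matApp_inv_add_smul hB ha v
  set w := matApp ((1 + a • B)⁻¹) v
  have hle : ‖w‖ ≤ ‖v‖ := by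
    have h := norm_le_norm_add_smul_matApp_s15 hB ha w
    rwa [hw] at h
  have heq : w - (v - a • matApp B v) = (a ^ 2) • matApp B (matApp B w) := by
    rw [← hw]
    simp only [matApp, map_add, map_smul]
    module
  rw [heq, norm_smul, Real.norm_of_nonneg (sq_nonneg a), mul_assoc]
  refine mul_le_mul_of_nonneg_left ?_ (sq_nonneg a)
  refine (ContinuousLinearMap.le_opNorm _ _).trans ?_
  rw [pow_two, mul_assoc]
  refine mul_le_mul_of_nonneg_left ?_ (norm_nonneg _)
  exact (ContinuousLinearMap.le_opNorm _ _).trans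
    (mul_le_mul_of_nonneg_left hle (norm_nonneg _))

variable {X : Type*} {l : Filter X}

theorem isBigO_matApp {B : X → Matrix (Fin d) (Fin d) ℝ} {v : X → EuclideanSpace ℝ (Fin d)}
    {g : X → ℝ}
    (hB : (fun x => Matrix.toEuclideanCLM (𝕜 := ℝ) (B x)) =O[l] (fun _ => (1 : ℝ)))
    (hv : v =O[l] g) : (fun x => matApp (B x) (v x)) =O[l] g := by
  have h := hB.norm_left.mul hv.norm_left
  simp only [one_mul] at h
  refine IsBigO.trans (IsBigO.of_bound 1 (Eventually.of_forall fun x => ?_)) h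
  rw [one_mul, norm_mul, norm_norm, norm_norm]
  exact ContinuousLinearMap.le_opNorm _ _

theorem isBigO_matApp_inv_sub {h : X → ℝ} (hh : ∀ᶠ x in l, 0 ≤ h x) {a : ℝ} (ha : 0 ≤ a)
    {B : X → Matrix (Fin d) (Fin d) ℝ} {v : X → EuclideanSpace ℝ (Fin d)}
    (hB : (fun x => Matrix.toEuclideanCLM (𝕜 := ℝ) (B x)) =O[l] (fun _ => (1 : ℝ)))
    (hpd : ∀ᶠ x in l, (B x).PosDef) (hv : v =O[l] (fun _ => (1 : ℝ))) :
    (fun x => matApp ((1 + (a * h x) • B x)⁻¹) (v x) - (v x - (a * h x) • matApp (B x) (v x)))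
      =O[l] (fun x => h x ^ 2) := by
  have h1 : (fun x => (a * h x) ^ 2 * ‖Matrix.toEuclideanCLM (𝕜 := ℝ) (B x)‖ ^ 2 * ‖v x‖)
      =O[l] (fun x => h x ^ 2) := by
    have := ((((isBigO_refl h l).const_mul_left a).pow 2).mul (hB.norm_left.pow 2)).mul
      hv.norm_left
    simpa using this
  refine IsBigO.trans (IsBigO.of_bound 1 ?_) h1
  filter_upwards [hh, hpd] with x hx hp
  rw [one_mul]
  exact (norm_matApp_inv_sub_le hp (mul_nonneg ha hx) (v x)).trans (le_abs_self _)

variable {h : X → ℝ} {u : X → EuclideanSpace ℝ (Fin d)}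

theorem isBigO_sub_of_expansion (hb : h =O[l] (fun _ => (1 : ℝ)))
    {v w : X → EuclideanSpace ℝ (Fin d)} (hw : w =O[l] (fun _ => (1 : ℝ)))
    (hv : (fun x => v x - (u x - h x • w x)) =O[l] (fun x => h x ^ 2)) :
    (fun x => v x - u x) =O[l] h := by
  have h2 : (fun x => h x ^ 2) =O[l] h := by
    simpa [pow_two] using (isBigO_refl h l).mul hb
  have h1 : (fun x => h x • w x) =O[l] h := by
    simpa using (isBigO_refl h l).smul hw
  exact ((hv.trans h2).sub h1).congr_left fun x => by abel

theorem isBigO_one_of_sub (hb : h =O[l] (fun _ => (1 : ℝ)))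
    (hu : u =O[l] (fun _ => (1 : ℝ))) {v : X → EuclideanSpace ℝ (Fin d)}
    (hv : (fun x => v x - u x) =O[l] h) : v =O[l] (fun _ => (1 : ℝ)) :=
  ((hv.trans hb).add hu).congr_left fun x => by abel

theorem isBigO_const_smul (a : ℝ) {v : X → EuclideanSpace ℝ (Fin d)} {g : X → ℝ}
    (hv : v =O[l] g) : (fun x => a • v x) =O[l] g :=
  hv.const_smul_left a

theorem isBigO_sum_matApp {ι : Type*} {s : Finset ι}
    {B : ι → X → Matrix (Fin d) (Fin d) ℝ} {v : ι → X → EuclideanSpace ℝ (Fin d)} {g : X → ℝ}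
    (hB : ∀ i ∈ s,
      (fun x => Matrix.toEuclideanCLM (𝕜 := ℝ) (B i x)) =O[l] (fun _ => (1 : ℝ)))
    (hv : ∀ i ∈ s, v i =O[l] g) :
    (fun x => ∑ i ∈ s, matApp (B i x) (v i x)) =O[l] g :=
  IsBigO.fun_sum fun i hi => isBigO_matApp (hB i hi) (hv i hi)

/-- Expansion of one semi-implicit substep. -/
theorem isBigO_substep (hh : ∀ᶠ x in l, 0 ≤ h x) (hb : h =O[l] (fun _ => (1 : ℝ)))
    (hu : u =O[l] (fun _ => (1 : ℝ))) {a : ℝ} (ha : 0 ≤ a) {s : Finset ℕ}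
    {B : ℕ → X → Matrix (Fin d) (Fin d) ℝ} {Q : X → Matrix (Fin d) (Fin d) ℝ}
    {f v w : X → EuclideanSpace ℝ (Fin d)} {vs : ℕ → X → EuclideanSpace ℝ (Fin d)}
    (hB : ∀ i ∈ s,
      (fun x => Matrix.toEuclideanCLM (𝕜 := ℝ) (B i x)) =O[l] (fun _ => (1 : ℝ)))
    (hQ : (fun x => Matrix.toEuclideanCLM (𝕜 := ℝ) (Q x)) =O[l] (fun _ => (1 : ℝ)))
    (hpd : ∀ᶠ x in l, (Q x).PosDef) (hf : f =O[l] (fun _ => (1 : ℝ)))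
    (hw : w =O[l] (fun _ => (1 : ℝ)))
    (hv : (fun x => v x - (u x - h x • w x)) =O[l] (fun x => h x ^ 2))
    (hvs : ∀ i ∈ s, (fun x => vs i x - u x) =O[l] h) :
    (fun x => matApp ((1 + (a * h x) • Q x)⁻¹)
        (v x - (a * h x) • ((∑ i ∈ s, matApp (B i x) (vs i x)) + f x))
      - (u x - h x • (w x + a • (((∑ i ∈ s, matApp (B i x) (u x)) + matApp (Q x) (u x))
          + f x)))) =O[l] (fun x => h x ^ 2) := by
  have hah : (fun x => a * h x) =O[l] h := (isBigO_refl h l).const_mul_left a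
  have hvu := isBigO_sub_of_expansion hb hw hv
  have hsum : (fun x => (∑ i ∈ s, matApp (B i x) (vs i x)) + f x) =O[l] (fun _ => (1 : ℝ)) :=
    (isBigO_sum_matApp hB fun i hi => isBigO_one_of_sub hb hu (hvs i hi)).add hf
  have hdiff : (fun x => ∑ i ∈ s, matApp (B i x) (vs i x - u x)) =O[l] h :=
    isBigO_sum_matApp hB hvs
  have hinc : (fun x => (a * h x) • ((∑ i ∈ s, matApp (B i x) (vs i x)) + f x)) =O[l] h := by
    simpa using hah.smul hsum
  have hyu := (hvu.sub hinc).congr_left (f₂ := fun x =>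
    (v x - (a * h x) • ((∑ i ∈ s, matApp (B i x) (vs i x)) + f x)) - u x) fun x => by abel
  have hres := isBigO_matApp_inv_sub hh ha hQ hpd (isBigO_one_of_sub hb hu hyu)
  have hQy : (fun x => (a * h x) • matApp (Q x)
      ((v x - (a * h x) • ((∑ i ∈ s, matApp (B i x) (vs i x)) + f x)) - u x))
      =O[l] (fun x => h x ^ 2) := by
    simpa [pow_two] using hah.smul (isBigO_matApp hQ hyu)
  have hBd : (fun x => (a * h x) • ∑ i ∈ s, matApp (B i x) (vs i x - u x))
      =O[l] (fun x => h x ^ 2) := by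
    simpa [pow_two] using hah.smul hdiff
  refine (((hres.add hv).sub hQy).sub hBd).congr_left fun x => ?_
  simp only [matApp, map_sub, Finset.sum_sub_distrib]
  module

theorem isBigO_average {n : ℕ} (hn : 1 ≤ n) {p : ℝ} {y g : ℕ → X → EuclideanSpace ℝ (Fin d)}
    {w : X → EuclideanSpace ℝ (Fin d)}
    (hy : ∀ k ∈ Icc 1 n, (fun x => y k x - (u x - h x • (w x + (p * (n : ℝ)) • g k x)))
      =O[l] (fun x => h x ^ 2)) :
    (fun x => (n : ℝ)⁻¹ • ∑ k ∈ Icc 1 n, y k x - (u x - h x • (w x + p • ∑ k ∈ Icc 1 n, g k x)))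
      =O[l] (fun x => h x ^ 2) := by
  have hne : (n : ℝ) ≠ 0 := by positivity
  refine ((IsBigO.fun_sum hy).const_smul_left ((n : ℝ)⁻¹)).congr_left fun x => ?_
  have hconst : ∑ k ∈ Icc 1 n, (y k x - (u x - h x • (w x + (p * (n : ℝ)) • g k x)))
      = ∑ k ∈ Icc 1 n, y k x
        - (n : ℝ) • (u x - h x • (w x + p • ∑ k ∈ Icc 1 n, g k x)) := by
    simp only [Finset.sum_sub_distrib, Finset.sum_add_distrib, ← Finset.smul_sum,
      Finset.sum_const, Nat.card_Icc, Nat.add_sub_cancel, ← Nat.cast_smul_eq_nsmul ℝ]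
    module
  simp only [Pi.smul_apply, hconst, smul_sub ((n : ℝ)⁻¹), inv_smul_smul₀ hne]

/-- The data of one grid level are bounded along `l`, with positive definite implicit part
and nonempty channel sets. -/
structure LevelAdmissible (l : Filter X) (cj : ℕ → ℕ) (N : ℕ)
    (B : ℕ → ℕ → ℕ → X → Matrix (Fin d) (Fin d) ℝ) (Q : ℕ → ℕ → X → Matrix (Fin d) (Fin d) ℝ)
    (f : ℕ → ℕ → X → EuclideanSpace ℝ (Fin d)) : Prop where
  channel_pos : ∀ m ∈ Icc 1 N, 1 ≤ cj m
  operator_bounded : ∀ m ∈ Icc 1 N, ∀ k ∈ Icc 1 (cj m), ∀ s ∈ Icc 1 (cj (m - 1)),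
    (fun x => Matrix.toEuclideanCLM (𝕜 := ℝ) (B m k s x)) =O[l] (fun _ => (1 : ℝ))
  implicit_bounded : ∀ m ∈ Icc 1 N, ∀ k ∈ Icc 1 (cj m),
    (fun x => Matrix.toEuclideanCLM (𝕜 := ℝ) (Q m k x)) =O[l] (fun _ => (1 : ℝ))
  implicit_posDef : ∀ m ∈ Icc 1 N, ∀ k ∈ Icc 1 (cj m), ∀ᶠ x in l, (Q m k x).PosDef
  source_bounded : ∀ m ∈ Icc 1 N, ∀ k ∈ Icc 1 (cj m), f m k =O[l] (fun _ => (1 : ℝ))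

/-- Expansion of the substeps performed at one grid level. -/
theorem isBigO_levelSub (hh : ∀ᶠ x in l, 0 ≤ h x) (hb : h =O[l] (fun _ => (1 : ℝ)))
    (hu : u =O[l] (fun _ => (1 : ℝ))) {p : ℝ} (hp : 0 ≤ p) {cj : ℕ → ℕ} {N : ℕ}
    {B : ℕ → ℕ → ℕ → X → Matrix (Fin d) (Fin d) ℝ} {Q : ℕ → ℕ → X → Matrix (Fin d) (Fin d) ℝ}
    {f : ℕ → ℕ → X → EuclideanSpace ℝ (Fin d)} (H : LevelAdmissible l cj N B Q f)
    {v : X → EuclideanSpace ℝ (Fin d) × (ℕ → EuclideanSpace ℝ (Fin d))}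
    {w : X → EuclideanSpace ℝ (Fin d)} (hw : w =O[l] (fun _ => (1 : ℝ)))
    (hv : (fun x => (v x).1 - (u x - h x • w x)) =O[l] (fun x => h x ^ 2))
    (hvs : ∀ i ∈ Icc 1 (cj 0), (fun x => (v x).2 i - u x) =O[l] h) {n : ℕ} (hn : n ≤ N) :
    ((fun x => levelIncrement cj (fun m k s => B m k s x) (fun m k => Q m k x)
        (fun m k => f m k x) (u x) n) =O[l] (fun _ => (1 : ℝ))) ∧
      ((fun x => (levelSub d p cj (fun m k s => B m k s x) (fun m k => Q m k x)
            (fun m k => f m k x) (h x) (v x) n).1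
          - (u x - h x • (w x + p • levelIncrement cj (fun m k s => B m k s x)
            (fun m k => Q m k x) (fun m k => f m k x) (u x) n))) =O[l] (fun x => h x ^ 2)) ∧
      ∀ k ∈ Icc 1 (cj n), (fun x => (levelSub d p cj (fun m k s => B m k s x)
        (fun m k => Q m k x) (fun m k => f m k x) (h x) (v x) n).2 k - u x) =O[l] h := by
  induction n with
  | zero =>
    refine ⟨(isBigO_zero _ _).congr_left fun x => by simp [levelIncrement], ?_, hvs⟩
    simpa [levelSub, levelIncrement] using hv
  | succ n ih =>
    obtain ⟨ihG, ihv, ihs⟩ := ih (by omega)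
    have hmem : n + 1 ∈ Icc 1 N := mem_Icc.2 ⟨Nat.le_add_left 1 n, hn⟩
    have hg : ∀ k ∈ Icc 1 (cj (n + 1)), (fun x =>
        ((∑ s ∈ Icc 1 (cj (n + 1 - 1)), matApp (B (n + 1) k s x) (u x))
          + matApp (Q (n + 1) k x) (u x)) + f (n + 1) k x) =O[l] (fun _ => (1 : ℝ)) := fun k hk =>
      ((isBigO_sum_matApp (H.operator_bounded _ hmem k hk) fun _ _ => hu).add
        (isBigO_matApp (H.implicit_bounded _ hmem k hk) hu)).add (H.source_bounded _ hmem k hk)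
    have hsucc : ∀ x, levelIncrement cj (fun m k s => B m k s x) (fun m k => Q m k x)
        (fun m k => f m k x) (u x) (n + 1)
        = levelIncrement cj (fun m k s => B m k s x) (fun m k => Q m k x)
          (fun m k => f m k x) (u x) n + ∑ k ∈ Icc 1 (cj (n + 1)),
          (((∑ s ∈ Icc 1 (cj n), matApp (B (n + 1) k s x) (u x)) + matApp (Q (n + 1) k x) (u x))
          + f (n + 1) k x) := fun x => Finset.sum_Icc_succ_top (Nat.le_add_left 1 n) _
    have hW : (fun x => w x + p • levelIncrement cj (fun m k s => B m k s x)
        (fun m k => Q m k x) (fun m k => f m k x) (u x) n) =O[l] (fun _ => (1 : ℝ)) :=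
      hw.add (isBigO_const_smul p ihG)
    have hstep := fun k (hk : k ∈ Icc 1 (cj (n + 1))) =>
      isBigO_substep (a := p * (cj (n + 1) : ℝ)) hh hb hu (by positivity) (H.operator_bounded _ hmem k hk)
        (H.implicit_bounded _ hmem k hk) (H.implicit_posDef _ hmem k hk) (H.source_bounded _ hmem k hk) hW ihv ihs
    refine ⟨?_, ?_, fun k hk => ?_⟩
    · simp only [hsucc]
      exact ihG.add (IsBigO.fun_sum hg)
    · refine (isBigO_average (H.channel_pos _ hmem) hstep).congr_left fun x => ?_
      rw [hsucc, smul_add p, ← add_assoc]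
      rfl
    · exact isBigO_sub_of_expansion hb
        (hW.add (isBigO_const_smul (p * (cj (n + 1) : ℝ)) (hg k hk))) (hstep k hk)

theorem levelSub_fst_eq_average {p : ℝ} {cj : ℕ → ℕ}
    {B : ℕ → ℕ → ℕ → Matrix (Fin d) (Fin d) ℝ} {Q : ℕ → ℕ → Matrix (Fin d) (Fin d) ℝ}
    {f : ℕ → ℕ → EuclideanSpace ℝ (Fin d)} {τ : ℝ}
    {v : EuclideanSpace ℝ (Fin d) × (ℕ → EuclideanSpace ℝ (Fin d))} {n : ℕ} (hn : 1 ≤ n) :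
    (levelSub d p cj B Q f τ v n).1
      = (cj n : ℝ)⁻¹ • ∑ k ∈ Icc 1 (cj n), (levelSub d p cj B Q f τ v n).2 k := by
  obtain ⟨n, rfl⟩ := Nat.exists_eq_succ_of_ne_zero (Nat.one_le_iff_ne_zero.1 hn)
  rfl

variable {J : ℕ} {M : ℕ → ℕ} {c : ℕ → ℕ → ℕ}
  {A : ℕ → ℕ → ℕ → ℕ → ℝ → Matrix (Fin d) (Fin d) ℝ}
  {S : ℕ → ℕ → ℕ → ℝ → Matrix (Fin d) (Fin d) ℝ}
  {f : ℕ → ℕ → ℕ → ℝ → EuclideanSpace ℝ (Fin d)} {t₀ t₁ : X → ℝ}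

theorem isBigO_alg6Left (hh : ∀ᶠ x in l, 0 ≤ h x) (hb : h =O[l] (fun _ => (1 : ℝ)))
    (hu : u =O[l] (fun _ => (1 : ℝ))) {P : ℕ}
    (hc0 : ∀ j ∈ Icc 1 P, c j 0 = c (j - 1) (M (j - 1)))
    (H : ∀ j ∈ Icc 1 P, LevelAdmissible l (c j) (M j) (fun m k s x => A j m k s (t₀ x))
      (fun m k x => S j m k (t₁ x)) (fun m k x => f j m k (t₀ x)))
    {G : ℕ → X → EuclideanSpace ℝ (Fin d)}
    (hG : ∀ j x, G j x = levelIncrement (c j) (fun m k s => A j m k s (t₀ x))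
      (fun m k => S j m k (t₁ x)) (fun m k => f j m k (t₀ x)) (u x) (M j))
    {j : ℕ} (hj : j ≤ P) :
    ((fun x => ∑ i ∈ range j, (2 : ℝ) ^ i • G (i + 1) x) =O[l] (fun _ => (1 : ℝ))) ∧
      ((fun x => (alg6Left d M c A S f (h x) (t₀ x) (t₁ x) (u x) j).1
        - (u x - h x • ∑ i ∈ range j, (2 : ℝ) ^ i • G (i + 1) x)) =O[l] (fun x => h x ^ 2)) ∧
      ∀ k ∈ Icc 1 (c j (M j)),
        (fun x => (alg6Left d M c A S f (h x) (t₀ x) (t₁ x) (u x) j).2 k - u x) =O[l] h := by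
  induction j with
  | zero =>
    refine ⟨(isBigO_zero _ _).congr_left fun x => by simp,
      (isBigO_zero _ _).congr_left fun x => by simp [alg6Left], fun k _ =>
      (isBigO_zero _ _).congr_left fun x => by simp [alg6Left]⟩
  | succ j ih =>
    obtain ⟨ihW, ihv, ihs⟩ := ih (by omega)
    have hmem : j + 1 ∈ Icc 1 P := mem_Icc.2 ⟨Nat.le_add_left 1 j, hj⟩
    have hc := hc0 _ hmem
    rw [Nat.add_sub_cancel] at hc
    rw [← hc] at ihs
    obtain ⟨h1, h2, h3⟩ := isBigO_levelSub hh hb hu (p := (2 : ℝ) ^ j) (by positivity)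
      (H _ hmem) ihW ihv ihs le_rfl
    simp only [← hG] at h1 h2
    simp only [Finset.sum_range_succ]
    exact ⟨ihW.add (isBigO_const_smul _ h1), h2, h3⟩

theorem alg6Right_succ_fst {τ s₀ s₁ : ℝ} {v : EuclideanSpace ℝ (Fin d)} {i q : ℕ}
    (hJ : i + q + 2 = J) (hM : 1 ≤ M (J + i + 1)) (hMq : 1 ≤ M (q + 1))
    (hc : c (J + i + 1) (M (J + i + 1)) = c (q + 1) (M (q + 1))) :
    (alg6Right d J M c A S f τ s₀ s₁ v (i + 1)).1
      = (1 / 2 : ℝ) • (levelSub d ((2 : ℝ) ^ (q + 1)) (c (J + i + 1))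
          (fun m k s => A (J + i + 1) m k s s₀) (fun m k => S (J + i + 1) m k s₁)
          (fun m k => f (J + i + 1) m k s₀) τ (alg6Right d J M c A S f τ s₀ s₁ v i)
          (M (J + i + 1))).1
        + (1 / 2 : ℝ) • (alg6Left d M c A S f τ s₀ s₁ v (q + 1)).1 := by
  have hq : 2 * J - (J + i + 1) = q + 1 := by omega
  rw [levelSub_fst_eq_average hM]
  simp only [alg6Left]
  rw [levelSub_fst_eq_average hMq, ← hc]
  simp only [alg6Right, hq, alg6Left, Finset.sum_add_distrib, ← Finset.smul_sum]
  module

theorem isBigO_alg6Right (hh : ∀ᶠ x in l, 0 ≤ h x) (hb : h =O[l] (fun _ => (1 : ℝ)))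
    (hu : u =O[l] (fun _ => (1 : ℝ))) (hM : ∀ j ∈ Icc 1 (2 * J - 1), 1 ≤ M j)
    (hc0 : ∀ j ∈ Icc 1 (2 * J - 1), c j 0 = c (j - 1) (M (j - 1)))
    (hc_compat : ∀ j, J < j → j ≤ 2 * J - 1 → c j (M j) = c (2 * J - j) (M (2 * J - j)))
    (H : ∀ j ∈ Icc 1 (2 * J - 1), LevelAdmissible l (c j) (M j)
      (fun m k s x => A j m k s (t₀ x))
      (fun m k x => S j m k (t₁ x)) (fun m k x => f j m k (t₀ x)))
    {G : ℕ → X → EuclideanSpace ℝ (Fin d)}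
    (hG : ∀ j x, G j x = levelIncrement (c j) (fun m k s => A j m k s (t₀ x))
      (fun m k => S j m k (t₁ x)) (fun m k => f j m k (t₀ x)) (u x) (M j))
    {i q : ℕ} (hi : i + q + 1 = J) :
    ((fun x => ∑ j ∈ range (q + 1), (2 : ℝ) ^ j • G (j + 1) x
        + (2 : ℝ) ^ q • ∑ j ∈ Ioc (q + 1) (J + i), G j x) =O[l] (fun _ => (1 : ℝ))) ∧
      ((fun x => (alg6Right d J M c A S f (h x) (t₀ x) (t₁ x) (u x) i).1
        - (u x - h x • (∑ j ∈ range (q + 1), (2 : ℝ) ^ j • G (j + 1) x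
          + (2 : ℝ) ^ q • ∑ j ∈ Ioc (q + 1) (J + i), G j x))) =O[l] (fun x => h x ^ 2)) ∧
      ∀ k ∈ Icc 1 (c (J + i) (M (J + i))),
        (fun x => (alg6Right d J M c A S f (h x) (t₀ x) (t₁ x) (u x) i).2 k - u x) =O[l] h := by
  induction i generalizing q with
  | zero =>
    obtain rfl : J = q + 1 := by omega
    simpa only [alg6Right, Nat.add_zero, Ioc_self, Finset.sum_empty, smul_zero, add_zero] using
      isBigO_alg6Left (j := q + 1) hh hb hu hc0 H hG (by omega)
  | succ i ih =>
    obtain ⟨ihW, ihv, ihs⟩ := ih (q := q + 1) (by omega)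
    have hmem : J + i + 1 ∈ Icc 1 (2 * J - 1) := mem_Icc.2 ⟨by omega, by omega⟩
    have hq : 2 * J - (J + i + 1) = q + 1 := by omega
    have hc := hc0 _ hmem
    have hcc := hc_compat (J + i + 1) (by omega) (by omega)
    rw [Nat.add_sub_cancel] at hc
    rw [hq] at hcc
    rw [← hc] at ihs
    obtain ⟨h1, h2, h3⟩ := isBigO_levelSub hh hb hu (p := (2 : ℝ) ^ (q + 1)) (by positivity)
      (H _ hmem) ihW ihv ihs le_rfl
    obtain ⟨l1, l2, l3⟩ := isBigO_alg6Left (j := q + 1) hh hb hu hc0 H hG (by omega)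
    simp only [← hG] at h1 h2
    have hIoc : ∀ x, ∑ j ∈ Ioc (q + 1) (J + (i + 1)), G j x
        = G (q + 2) x + ∑ j ∈ Ioc (q + 2) (J + i), G j x + G (J + i + 1) x := fun x => by
      rw [← add_assoc, Finset.sum_Ioc_succ_top (by omega),
        ← Finset.sum_Ioc_consecutive _ (Nat.le_succ (q + 1)) (by omega : q + 2 ≤ J + i)]
      simp
    have hcomb : ∀ x, ∑ j ∈ range (q + 1), (2 : ℝ) ^ j • G (j + 1) x
          + (2 : ℝ) ^ q • ∑ j ∈ Ioc (q + 1) (J + (i + 1)), G j x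
        = (1 / 2 : ℝ) • (∑ j ∈ range (q + 1 + 1), (2 : ℝ) ^ j • G (j + 1) x
          + (2 : ℝ) ^ (q + 1) • ∑ j ∈ Ioc (q + 1 + 1) (J + i), G j x
          + (2 : ℝ) ^ (q + 1) • G (J + i + 1) x)
          + (1 / 2 : ℝ) • ∑ j ∈ range (q + 1), (2 : ℝ) ^ j • G (j + 1) x := fun x => by
      rw [hIoc, Finset.sum_range_succ _ (q + 1), pow_succ]
      module
    refine ⟨?_, ?_, fun k hk => ?_⟩
    · simp only [hcomb]
      exact (isBigO_const_smul _ (ihW.add (isBigO_const_smul _ h1))).add (isBigO_const_smul _ l1)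
    · refine ((h2.const_smul_left (1 / 2 : ℝ)).add (l2.const_smul_left (1 / 2 : ℝ))).congr_left
        fun x => ?_
      rw [hcomb, alg6Right_succ_fst (by omega) (hM _ hmem)
        (hM _ (mem_Icc.2 ⟨by omega, by omega⟩)) hcc]
      simp only [Pi.smul_apply]
      module
    · refine (((h3 k hk).const_smul_left (1 / 2 : ℝ)).add
        ((l3 k (hcc ▸ hk)).const_smul_left (1 / 2 : ℝ))).congr_left fun x => ?_
      simp only [alg6Right, hq, Pi.smul_apply]
      module

theorem isBigO_one_of_lipschitzOnWith {E : Type*} [SeminormedAddCommGroup E] {F : ℝ → E}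
    {L : NNReal} {T : ℝ} (hF : LipschitzOnWith L F (Set.Icc 0 T)) {t : X → ℝ}
    (ht : ∀ᶠ x in l, t x ∈ Set.Icc 0 T) : (fun x => F (t x)) =O[l] (fun _ => (1 : ℝ)) := by
  refine IsBigO.of_bound (‖F 0‖ + L * T) ?_
  filter_upwards [ht] with x hx
  have h0 : (0 : ℝ) ∈ Set.Icc 0 T := ⟨le_rfl, hx.1.trans hx.2⟩
  have h1 := hF.norm_sub_le hx h0
  rw [sub_zero, Real.norm_of_nonneg hx.1] at h1
  have h2 : (L : ℝ) * t x ≤ L * T := mul_le_mul_of_nonneg_left hx.2 L.2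
  rw [norm_one, mul_one]
  linarith [norm_le_norm_add_norm_sub' (F (t x)) (F 0)]

end LocalTruncation

/-- **Second-order local truncation error of the general hybrid splitting scheme with
relaxation (Algorithm 6):** one step starting from `u^n` equals
`u^n − Δt Z̃(t^n) u^n − Δt f(t^n)` up to `C Δt²`, uniformly for `‖u^n‖ ≤ R`. -/
theorem general_hybrid_splitting_local_truncation_second_order
    (d J : ℕ) (hd : 1 ≤ d) (hJ : 1 ≤ J) (T : ℝ) (hT : 0 < T)
    (M : ℕ → ℕ) (hM : ∀ j ∈ Finset.Icc 1 (2 * J - 1), 1 ≤ M j)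
    (c : ℕ → ℕ → ℕ)
    (hc_pos : ∀ j ∈ Finset.Icc 1 (2 * J - 1), ∀ m ∈ Finset.Icc 1 (M j), 1 ≤ c j m)
    (hc00 : c 0 (M 0) = 1)
    (hc0 : ∀ j ∈ Finset.Icc 1 (2 * J - 1), c j 0 = c (j - 1) (M (j - 1)))
    (hc_compat : ∀ j, J < j → j ≤ 2 * J - 1 → c j (M j) = c (2 * J - j) (M (2 * J - j)))
    (A : ℕ → ℕ → ℕ → ℕ → ℝ → Matrix (Fin d) (Fin d) ℝ)
    (S : ℕ → ℕ → ℕ → ℝ → Matrix (Fin d) (Fin d) ℝ)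
    (f : ℕ → ℕ → ℕ → ℝ → EuclideanSpace ℝ (Fin d))
    (Astar : ℕ → ℝ → Matrix (Fin d) (Fin d) ℝ)
    (Sstar : ℝ → Matrix (Fin d) (Fin d) ℝ)
    (fstar : ℝ → EuclideanSpace ℝ (Fin d))
    (L : NNReal)
    (hA_lip : ∀ j ∈ Finset.Icc 1 (2 * J - 1), ∀ m ∈ Finset.Icc 1 (M j),
      ∀ k ∈ Finset.Icc 1 (c j m), ∀ s ∈ Finset.Icc 1 (c j (m - 1)),
      LipschitzOnWith L (fun t => Matrix.toEuclideanCLM (𝕜 := ℝ) (A j m k s t)) (Set.Icc 0 T))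
    (hA_pd : ∀ j ∈ Finset.Icc 1 (2 * J - 1), ∀ m ∈ Finset.Icc 1 (M j),
      ∀ k ∈ Finset.Icc 1 (c j m), ∀ s ∈ Finset.Icc 1 (c j (m - 1)),
      ∀ t ∈ Set.Icc (0 : ℝ) T, (A j m k s t).PosDef)
    (hS_lip : ∀ j ∈ Finset.Icc 1 (2 * J - 1), ∀ m ∈ Finset.Icc 1 (M j),
      ∀ k ∈ Finset.Icc 1 (c j m),
      LipschitzOnWith L (fun t => Matrix.toEuclideanCLM (𝕜 := ℝ) (S j m k t)) (Set.Icc 0 T))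
    (hS_pd : ∀ j ∈ Finset.Icc 1 (2 * J - 1), ∀ m ∈ Finset.Icc 1 (M j),
      ∀ k ∈ Finset.Icc 1 (c j m), ∀ t ∈ Set.Icc (0 : ℝ) T, (S j m k t).PosDef)
    (hf_lip : ∀ j ∈ Finset.Icc 1 (2 * J - 1), ∀ m ∈ Finset.Icc 1 (M j),
      ∀ k ∈ Finset.Icc 1 (c j m), LipschitzOnWith L (f j m k) (Set.Icc 0 T))
    (hAstar_lip : ∀ s ∈ Finset.Icc 1 (c (2 * J - 1) (M (2 * J - 1))),
      LipschitzOnWith L (fun t => Matrix.toEuclideanCLM (𝕜 := ℝ) (Astar s t)) (Set.Icc 0 T))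
    (hAstar_pd : ∀ s ∈ Finset.Icc 1 (c (2 * J - 1) (M (2 * J - 1))),
      ∀ t ∈ Set.Icc (0 : ℝ) T, (Astar s t).PosDef)
    (hSstar_lip :
      LipschitzOnWith L (fun t => Matrix.toEuclideanCLM (𝕜 := ℝ) (Sstar t)) (Set.Icc 0 T))
    (hSstar_pd : ∀ t ∈ Set.Icc (0 : ℝ) T, (Sstar t).PosDef)
    (hfstar_lip : LipschitzOnWith L fstar (Set.Icc 0 T))
    (R : ℝ) (hR : 0 < R) :
    ∃ C > (0 : ℝ), ∃ Δt₀ > (0 : ℝ), ∀ Δt : ℝ, 0 < Δt → Δt ≤ Δt₀ → ∀ n : ℕ,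
      ((n : ℝ) + 1) * Δt ≤ T → ∀ un : EuclideanSpace ℝ (Fin d), ‖un‖ ≤ R →
      ‖alg6Step d J M c A S f Astar Sstar fstar
            Δt ((n : ℝ) * Δt) (((n : ℝ) + 1) * Δt) un
        - (un
            - Δt • ((∑ j ∈ Finset.Icc 1 (2 * J - 1), ∑ m ∈ Finset.Icc 1 (M j),
                  ∑ k ∈ Finset.Icc 1 (c j m),
                  ((∑ s ∈ Finset.Icc 1 (c j (m - 1)),
                      matApp (A j m k s ((n : ℝ) * Δt)) un)
                    + matApp (S j m k (((n : ℝ) + 1) * Δt)) un))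
                + ((∑ s ∈ Finset.Icc 1 (c (2 * J - 1) (M (2 * J - 1))),
                      matApp (Astar s ((n : ℝ) * Δt)) un)
                    + matApp (Sstar (((n : ℝ) + 1) * Δt)) un))
            - Δt • ((∑ j ∈ Finset.Icc 1 (2 * J - 1), ∑ m ∈ Finset.Icc 1 (M j),
                  ∑ k ∈ Finset.Icc 1 (c j m), f j m k ((n : ℝ) * Δt))
                + fstar ((n : ℝ) * Δt)))‖ ≤ C * Δt ^ 2 := by
  let X := ℝ × ℕ × EuclideanSpace ℝ (Fin d)
  let h : X → ℝ := fun x => x.1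
  let u : X → EuclideanSpace ℝ (Fin d) := fun x => x.2.2
  let t₀ : X → ℝ := fun x => (x.2.1 : ℝ) * x.1
  let t₁ : X → ℝ := fun x => ((x.2.1 : ℝ) + 1) * x.1
  let l : Filter X :=
    Filter.principal {x | 0 < x.1 ∧ x.1 ≤ 1 ∧ ((x.2.1 : ℝ) + 1) * x.1 ≤ T ∧ ‖x.2.2‖ ≤ R}
  have hh : ∀ᶠ x in l, 0 ≤ h x := Filter.eventually_principal.2 fun x hx => hx.1.le
  have hb : h =O[l] (fun _ => (1 : ℝ)) :=
    Asymptotics.IsBigO.of_bound 1 (Filter.eventually_principal.2 fun x hx => by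
      rw [Real.norm_of_nonneg hx.1.le, norm_one, mul_one]; exact hx.2.1)
  have hu : u =O[l] (fun _ => (1 : ℝ)) :=
    Asymptotics.IsBigO.of_bound R (Filter.eventually_principal.2 fun x hx => by
      rw [norm_one, mul_one]; exact hx.2.2.2)
  have ht₀ : ∀ᶠ x in l, t₀ x ∈ Set.Icc 0 T := Filter.eventually_principal.2 fun x hx => by
    obtain ⟨hpos, -, hle, -⟩ := hx
    exact ⟨by positivity, by simp only [t₀]; linarith⟩
  have ht₁ : ∀ᶠ x in l, t₁ x ∈ Set.Icc 0 T := Filter.eventually_principal.2 fun x hx => by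
    obtain ⟨hpos, -, hle, -⟩ := hx
    exact ⟨by positivity, hle⟩
  have H : ∀ j ∈ Icc 1 (2 * J - 1), LevelAdmissible l (c j) (M j)
      (fun m k s x => A j m k s (t₀ x)) (fun m k x => S j m k (t₁ x))
      (fun m k x => f j m k (t₀ x)) := fun j hj =>
    { channel_pos := hc_pos j hj
      operator_bounded := fun m hm k hk s hs =>
        isBigO_one_of_lipschitzOnWith (hA_lip j hj m hm k hk s hs) ht₀
      implicit_bounded := fun m hm k hk =>
        isBigO_one_of_lipschitzOnWith (hS_lip j hj m hm k hk) ht₁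
      implicit_posDef := fun m hm k hk => ht₁.mono fun x hx => hS_pd j hj m hm k hk _ hx
      source_bounded := fun m hm k hk =>
        isBigO_one_of_lipschitzOnWith (hf_lip j hj m hm k hk) ht₀ }
  obtain ⟨hW, hv, hvs⟩ := isBigO_alg6Right (i := J - 1) (q := 0) hh hb hu hM hc0 hc_compat H
    (fun _ _ => rfl) (by omega)
  have htop : J + (J - 1) = 2 * J - 1 := by omega
  rw [htop] at hvs
  have hstep := isBigO_substep hh hb hu zero_le_one
    (fun s hs => isBigO_one_of_lipschitzOnWith (hAstar_lip s hs) ht₀)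
    (isBigO_one_of_lipschitzOnWith hSstar_lip ht₁) (ht₁.mono fun x hx => hSstar_pd _ hx)
    (isBigO_one_of_lipschitzOnWith hfstar_lip ht₀) hW hv hvs
  obtain ⟨C, hC, hbound⟩ := hstep.exists_pos
  rw [Asymptotics.isBigOWith_iff, Filter.eventually_principal] at hbound
  refine ⟨C, hC, 1, one_pos, fun Δt hpos hle n hn un hun => ?_⟩
  have hx := hbound (Δt, n, un) ⟨hpos, hle, hn, hun⟩
  rw [Real.norm_of_nonneg (sq_nonneg _)] at hx
  refine le_of_eq_of_le (congrArg norm ?_) hx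
  have hsum : ∀ g : ℕ → EuclideanSpace ℝ (Fin d),
      ∑ j ∈ range (0 + 1), (2 : ℝ) ^ j • g (j + 1)
        + (2 : ℝ) ^ 0 • ∑ j ∈ Ioc (0 + 1) (J + (J - 1)), g j = ∑ j ∈ Icc 1 (2 * J - 1), g j := by
    intro g
    rw [htop, ← Finset.add_sum_Ioc_eq_sum_Icc (by omega : 1 ≤ 2 * J - 1)]
    simp
  simp only [h, u, t₀, t₁, alg6Step, one_mul, one_smul]
  congr 1
  rw [hsum fun j => levelIncrement (c j) (fun m k s => A j m k s (n * Δt))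
    (fun m k => S j m k ((n + 1) * Δt)) (fun m k => f j m k (n * Δt)) un (M j)]
  simp only [levelIncrement, Finset.sum_add_distrib]
  module
end
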